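/- arXiv:2505.13013 — 2 statements merged into one kernel-verified Lean document; each statement's English description precedes it below -/
import Mathlib

section
/- For every n ≥ 1, the spectrum Spec R(n) is irreducible (equivalently, the nilradical of R(n) is a prime ideal) and the Krull dimension of R(n) equals n² + n. -/
open MvPolynomial Matrix

noncomputable section

/-- Variables of the polynomial ring: the entries of the two generic `n × n` matrices. -/
abbrev Rvar (n : ℕ) := (Fin n × Fin n) ⊕ (Fin n × Fin n)

/-- The generic matrix `X_n`. -/
def Xgen (K : Type) [Field K] (n : ℕ) : Matrix (Fin n) (Fin n) (MvPolynomial (Rvar n) K) :=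
  Matrix.of fun i j => MvPolynomial.X (Sum.inl (i, j))

/-- The generic matrix `Y_n`. -/
def Ygen (K : Type) [Field K] (n : ℕ) : Matrix (Fin n) (Fin n) (MvPolynomial (Rvar n) K) :=
  Matrix.of fun i j => MvPolynomial.X (Sum.inr (i, j))

/-- The ideal `I(n)` generated by the `n²` entries of the commutator `[X_n, Y_n]`. -/
def commIdeal (K : Type) [Field K] (n : ℕ) : Ideal (MvPolynomial (Rvar n) K) :=
  Ideal.span (Set.range fun ij : Fin n × Fin n =>
    (Xgen K n * Ygen K n - Ygen K n * Xgen K n) ij.1 ij.2)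

/-- `R(n) = K[x_ij, y_ij]/I(n)`. -/
abbrev Rring (K : Type) [Field K] (n : ℕ) : Type :=
  MvPolynomial (Rvar n) K ⧸ commIdeal K n

section cyclic

open scoped Polynomial

/-- Every endomorphism of a finite-dimensional space over an algebraically closed field commutes
with an endomorphism that has a cyclic vector. -/
theorem exists_commute_cyclic {K : Type} [Field K] [IsAlgClosed K] {V : Type}
    [AddCommGroup V] [Module K V] [FiniteDimensional K V] (B : Module.End K V) :
    ∃ (R : Module.End K V) (v : V), Commute R B ∧
      ∀ w, ∃ q : K[X], Polynomial.aeval R q v = w := by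
  classical
  obtain ⟨ι, _, p, hp, e, ⟨E'⟩⟩ := Module.equiv_directSum_of_isTorsion
    (Module.AEval.isTorsion_of_finiteDimensional K V B)
  let E₁ : Module.AEval K V B ≃ₗ[K[X]] (∀ i, K[X] ⧸ Ideal.span {p i ^ e i}) :=
    E'.trans (DirectSum.linearEquivFunOnFintype K[X] ι _)
  let E : V ≃ₗ[K] (∀ i, K[X] ⧸ Ideal.span {p i ^ e i}) :=
    (Module.AEval.of K V B).trans (E₁.restrictScalars K)
  have hEB (x : V) : E (B x) = (Polynomial.X : K[X]) • E x := by
    have := E₁.map_smul (Polynomial.X : K[X]) (Module.AEval.of K V B x)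
    rw [Module.AEval.X_smul_of] at this
    exact this
  have hroot (i : ι) : ∃ a : K, Associated (p i) (Polynomial.X - Polynomial.C a) := by
    have hdeg := IsAlgClosed.degree_eq_one_of_irreducible K (hp i)
    obtain ⟨a, ha⟩ := IsAlgClosed.exists_root (p i) (by rw [hdeg]; exact one_ne_zero)
    exact ⟨a, ((Polynomial.irreducible_X_sub_C a).associated_of_dvd (hp i)
      (Polynomial.dvd_iff_isRoot.2 ha)).symm⟩
  choose a ha using hroot
  obtain ⟨μ⟩ : Nonempty (ι ↪ K) :=
    ⟨(Fintype.equivFin ι).toEmbedding.trans (Fin.valEmbedding.trans (Infinite.natEmbedding K))⟩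
  let g (i : ι) : K[X] := Polynomial.X + Polynomial.C (μ i - a i)
  let h (i : ι) : K[X] := Polynomial.X + Polynomial.C (a i - μ i)
  let D : Module.End K (∀ i, K[X] ⧸ Ideal.span {p i ^ e i}) :=
    { toFun f i := g i • f i
      map_add' f f' := by ext i; simp
      map_smul' c f := funext fun i => smul_comm (g i) c (f i) }
  let R : Module.End K V := E.symm.toLinearMap ∘ₗ D ∘ₗ E.toLinearMap
  have hER (x : V) (i : ι) : E (R x) i = g i • E x i := by simp [R, D]
  have haeval (q : K[X]) (x : V) (i : ι) :
      E (Polynomial.aeval R q x) i = q.comp (g i) • E x i := by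
    induction q using Polynomial.induction_on' with
    | add p q hp hq => simp [hp, hq, add_smul]
    | monomial k c =>
      rw [Polynomial.aeval_monomial, Polynomial.monomial_comp, Module.End.mul_apply,
        Module.algebraMap_end_apply, map_smul, Pi.smul_apply, mul_smul,
        ← Polynomial.algebraMap_eq, algebraMap_smul]
      congr 1
      induction k with
      | zero => simp
      | succ k ih => rw [pow_succ', Module.End.mul_apply, hER, ih, pow_succ', mul_smul]
  refine ⟨R, E.symm fun _ => 1, ?_, fun w => ?_⟩
  · ext x
    apply E.injective
    ext i
    simp only [Module.End.mul_apply, hER, hEB, Pi.smul_apply]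
    exact smul_comm _ _ _
  · choose r hr using fun i => Ideal.Quotient.mk_surjective (E w i)
    have hcop : Pairwise (Function.onFun IsCoprime
        fun i => Ideal.span {(Polynomial.X - Polynomial.C (μ i) : K[X]) ^ e i}) := fun i j hij =>
      (Ideal.isCoprime_span_singleton_iff _ _).2
        (Polynomial.pairwise_coprime_X_sub_C μ.injective hij).pow
    obtain ⟨q, hq⟩ := Ideal.exists_forall_sub_mem_ideal hcop fun i => (r i).comp (h i)
    refine ⟨q, E.injective ?_⟩
    ext i
    have hdvd : (Polynomial.X - Polynomial.C (a i)) ^ e i ∣ q.comp (g i) - r i := by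
      obtain ⟨c, hc⟩ := Ideal.mem_span_singleton.1 (hq i)
      refine ⟨c.comp (g i), ?_⟩
      have := congrArg (fun t => t.comp (g i)) hc
      simpa [g, h, Polynomial.comp_assoc, add_assoc, ← sub_eq_add_neg, ← Polynomial.C_add,
        add_sub_assoc] using this
    rw [haeval, LinearEquiv.apply_symm_apply, ← hr i]
    change Ideal.Quotient.mk _ (q.comp (g i) * 1) = _
    rw [mul_one, Ideal.Quotient.mk_eq_mk_iff_sub_mem, Ideal.mem_span_singleton]
    exact ((ha i).pow_pow.dvd).trans hdvd

end cyclic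

theorem ringKrullDim_eq_of_isIntegral {R S : Type*} [CommRing R] [CommRing S] [Algebra R S]
    [Algebra.IsIntegral R S] [FaithfulSMul R S] : ringKrullDim S = ringKrullDim R := by
  apply le_antisymm
  · refine Order.krullDim_le_of_strictMono (PrimeSpectrum.comap (algebraMap R S)) ?_
    intro P Q h
    exact Ideal.IsIntegral.comap_lt_comap h
  · refine iSup_le fun l => ?_
    obtain ⟨P, hP, hPl⟩ := (inferInstance : Nonempty (l.head.asIdeal.primesOver S))
    obtain ⟨L, hL, -⟩ := Ideal.exists_ltSeries_of_hasGoingUp l P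
    rw [← hL]
    exact Order.LTSeries.length_le_krullDim L

theorem ringKrullDim_eq_of_trdeg_eq {K A : Type} [Field K] [CommRing A] [IsDomain A]
    [Algebra K A] [Algebra.FiniteType K A] {d : ℕ} (h : Algebra.trdeg K A = d) :
    ringKrullDim A = d := by
  obtain ⟨s, g, hg, hgi⟩ := exists_integral_inj_algHom_of_fg K A
  algebraize [g.toRingHom]
  have : FaithfulSMul (MvPolynomial (Fin s) K) A := (faithfulSMul_iff_algebraMap_injective _ _).2 hg
  have : IsScalarTower K (MvPolynomial (Fin s) K) A := .of_algebraMap_eq fun x => (g.commutes x).symm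
  have hs := (IsTranscendenceBasis.mvPolynomial (Fin s) K).algebraMap_comp (A := A)
    |>.lift_cardinalMk_eq_trdeg
  have hsd : s = d := by
    rw [h] at hs
    simpa using hs
  rw [ringKrullDim_eq_of_isIntegral (R := MvPolynomial (Fin s) K),
    MvPolynomial.ringKrullDim_of_isNoetherianRing, ringKrullDim_eq_zero_of_field, hsd]
  simp

theorem ringKrullDim_quotient_nilradical (R : Type*) [CommRing R] :
    ringKrullDim (R ⧸ nilradical R) = ringKrullDim R := by
  rw [ringKrullDim_quotient, PrimeSpectrum.zeroLocus_nilradical]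
  exact Order.krullDim_eq_of_orderIso OrderIso.Set.univ

/-- The Krylov matrix of `A` and `v`, with columns `v, A v, …, A ^ (n - 1) v`. -/
def krylov {S : Type*} [CommRing S] {n : ℕ} (A : Matrix (Fin n) (Fin n) S) (v : Fin n → S) :
    Matrix (Fin n) (Fin n) S :=
  Matrix.of fun i k => (A ^ (k : ℕ) *ᵥ v) i

section krylov

variable {S T : Type*} [CommRing S] [CommRing T] {n : ℕ}

theorem krylov_mulVec (A : Matrix (Fin n) (Fin n) S) (v c : Fin n → S) :
    krylov A v *ᵥ c = (∑ k, c k • A ^ (k : ℕ)) *ᵥ v := by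
  ext i
  rw [Matrix.sum_mulVec, Finset.sum_apply]
  simp only [smul_mulVec, Pi.smul_apply, smul_eq_mul]
  change ∑ k, krylov A v i k * c k = _
  exact Finset.sum_congr rfl fun k _ => mul_comm (krylov A v i k) (c k)

theorem krylov_map (f : S →+* T) (A : Matrix (Fin n) (Fin n) S) (v : Fin n → S) :
    (krylov A v).map f = krylov (A.map f) (f ∘ v) := by
  ext i k
  simp only [krylov, Matrix.map_apply, Matrix.of_apply, RingHom.map_mulVec]
  rw [← RingHom.mapMatrix_apply, ← RingHom.mapMatrix_apply, map_pow]

theorem map_det_krylov (f : S →+* T) (A : Matrix (Fin n) (Fin n) S) (v : Fin n → S) :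
    f (krylov A v).det = (krylov (A.map f) (f ∘ v)).det := by
  rw [RingHom.map_det, RingHom.mapMatrix_apply, krylov_map]

theorem eq_sum_pow_of_commute {K : Type*} [Field K] {A B : Matrix (Fin n) (Fin n) K}
    {v : Fin n → K} (hv : (krylov A v).det ≠ 0) (h : Commute A B) :
    ∃ c : Fin n → K, B = ∑ k, c k • A ^ (k : ℕ) := by
  have hu : IsUnit (krylov A v) := (Matrix.isUnit_iff_isUnit_det _).2 hv.isUnit
  obtain ⟨c, hc⟩ := mulVec_surjective_iff_isUnit.2 hu (B *ᵥ v)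
  refine ⟨c, ?_⟩
  rw [krylov_mulVec] at hc
  have hcomm : Commute A (B - ∑ k, c k • A ^ (k : ℕ)) :=
    h.sub_right (Commute.sum_right _ _ _ fun k _ => ((Commute.refl A).pow_right _).smul_right _)
  have h0 : (B - ∑ k, c k • A ^ (k : ℕ)) * krylov A v = 0 := by
    ext i k
    have : ((B - ∑ k, c k • A ^ (k : ℕ)) *ᵥ (A ^ (k : ℕ) *ᵥ v)) i = 0 := by
      rw [mulVec_mulVec, ← (hcomm.pow_left k).eq, ← mulVec_mulVec, sub_mulVec, hc]
      simp
    exact this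
  exact sub_eq_zero.1 ((hu.mul_left_eq_zero).1 h0)

theorem exists_commute_det_krylov_ne_zero {K : Type} [Field K] [IsAlgClosed K] (hn : 1 ≤ n)
    (B : Matrix (Fin n) (Fin n) K) :
    ∃ (R : Matrix (Fin n) (Fin n) K) (v : Fin n → K), Commute R B ∧ (krylov R v).det ≠ 0 := by
  obtain ⟨R, v, hRB, hR⟩ := exists_commute_cyclic (toLin' B)
  refine ⟨LinearMap.toMatrix' R, v, ?_, ?_⟩
  · have := congrArg LinearMap.toMatrix' hRB.eq
    rwa [LinearMap.toMatrix'_mul, LinearMap.toMatrix'_mul, LinearMap.toMatrix'_toLin'] at this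
  · rw [← isUnit_iff_ne_zero, ← Matrix.isUnit_iff_isUnit_det, ← mulVec_surjective_iff_isUnit]
    intro w
    obtain ⟨q, hq⟩ := hR w
    have hdeg : R.charpoly.natDegree = n := by simp [LinearMap.charpoly_natDegree]
    have hlt : (q %ₘ R.charpoly).natDegree < n := by
      have := Polynomial.natDegree_modByMonic_lt q R.charpoly_monic (by
        intro h
        rw [h] at hdeg
        simp at hdeg
        omega)
      rwa [hdeg] at this
    refine ⟨fun k => (q %ₘ R.charpoly).coeff k, ?_⟩
    rw [krylov_mulVec, ← hq, ← Polynomial.aeval_modByMonic_eq_self_of_root R.aeval_self_charpoly,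
      Polynomial.aeval_eq_sum_range' hlt, Finset.sum_range, ← LinearMap.toMatrix'_mulVec]
    congr 1
    simp only [map_sum, map_smul]
    refine Finset.sum_congr rfl fun k _ => ?_
    congr 1
    exact (map_pow LinearMap.toMatrixAlgEquiv' R k).symm

end krylov

section evaluation

variable {K : Type} [Field K] {n : ℕ} {S : Type*} [CommRing S] [Algebra K S]

/-- Evaluation of polynomials in the entries of two generic matrices at a pair of matrices. -/
def evalPair (A B : Matrix (Fin n) (Fin n) S) : MvPolynomial (Rvar n) K →ₐ[K] S :=
  aeval (Sum.elim (fun ij => A ij.1 ij.2) fun ij => B ij.1 ij.2)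

theorem Xgen_map_evalPair (A B : Matrix (Fin n) (Fin n) S) :
    (Xgen K n).map (evalPair A B) = A := by
  ext i j
  simp [Xgen, evalPair]

theorem Ygen_map_evalPair (A B : Matrix (Fin n) (Fin n) S) :
    (Ygen K n).map (evalPair A B) = B := by
  ext i j
  simp [Ygen, evalPair]

theorem map_evalPair {T : Type*} [CommRing T] [Algebra K T] (f : S →ₐ[K] T)
    (A B : Matrix (Fin n) (Fin n) S) (p : MvPolynomial (Rvar n) K) :
    f (evalPair A B p) = evalPair (A.map f) (B.map f) p := by
  have : f.comp (evalPair (K := K) A B) = evalPair (A.map f) (B.map f) := by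
    ext (ij | ij) <;> simp [evalPair]
  exact DFunLike.congr_fun this p

theorem commIdeal_le_ker_evalPair_iff (A B : Matrix (Fin n) (Fin n) S) :
    commIdeal K n ≤ RingHom.ker (evalPair (K := K) A B) ↔ Commute A B := by
  have h : ((Xgen K n * Ygen K n - Ygen K n * Xgen K n).map (evalPair A B)) = A * B - B * A := by
    rw [Matrix.map_sub _ (map_sub _), Matrix.map_mul, Matrix.map_mul, Xgen_map_evalPair,
      Ygen_map_evalPair]
  rw [commIdeal, Ideal.span_le, Set.range_subset_iff, commute_iff_eq, ← sub_eq_zero, ← h,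
    ← Matrix.ext_iff]
  simp [RingHom.mem_ker]

end evaluation

section parametrization

variable (K : Type) [Field K] (n : ℕ)

/-- Coordinates on pairs of a matrix and a polynomial of degree less than `n`. -/
abbrev ParamRing := MvPolynomial ((Fin n × Fin n) ⊕ Fin n) K

/-- The generic matrix over `ParamRing K n`. -/
def paramX : Matrix (Fin n) (Fin n) (ParamRing K n) :=
  Matrix.of fun i j => X (Sum.inl (i, j))

/-- The generic polynomial of degree less than `n` in the generic matrix. -/
def paramY : Matrix (Fin n) (Fin n) (ParamRing K n) :=
  ∑ k, (X (Sum.inr k) : ParamRing K n) • paramX K n ^ (k : ℕ)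

/-- The comorphism of the map `(A, p) ↦ (A, p(A))`. -/
def paramHom : MvPolynomial (Rvar n) K →ₐ[K] ParamRing K n :=
  evalPair (paramX K n) (paramY K n)

variable {K n}

theorem commIdeal_le_ker_paramHom : commIdeal K n ≤ RingHom.ker (paramHom K n) :=
  (commIdeal_le_ker_evalPair_iff _ _).2
    (Commute.sum_right _ _ _ fun _ _ => ((Commute.refl _).pow_right _).smul_right _)

theorem evalPair_sum_pow_eq_zero {f : MvPolynomial (Rvar n) K} (hf : paramHom K n f = 0)
    (A : Matrix (Fin n) (Fin n) K) (c : Fin n → K) :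
    evalPair A (∑ k, c k • A ^ (k : ℕ)) f = 0 := by
  let g : ParamRing K n →ₐ[K] K := aeval (Sum.elim (fun ij => A ij.1 ij.2) c)
  have hX : (paramX K n).map g = A := by
    ext i j
    simp [paramX, g]
  have hY : (paramY K n).map g = ∑ k, c k • A ^ (k : ℕ) := by
    have h : g.mapMatrix (paramX K n) = A := hX
    change g.mapMatrix (paramY K n) = _
    rw [paramY, map_sum]
    refine Finset.sum_congr rfl fun k _ => ?_
    rw [← h, ← map_pow]
    ext i j
    simp [g]
  rw [← map_zero g, ← hf, paramHom, map_evalPair, hX, hY]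

theorem evalPair_eq_zero_of_commute [IsAlgClosed K] (hn : 1 ≤ n)
    {f : MvPolynomial (Rvar n) K} (hf : paramHom K n f = 0)
    {A B : Matrix (Fin n) (Fin n) K} (hAB : Commute A B) : evalPair A B f = 0 := by
  obtain ⟨R, v, hRB, hR⟩ := exists_commute_det_krylov_ne_zero hn B
  let M : Matrix (Fin n) (Fin n) (Polynomial K) :=
    A.map Polynomial.C + (Polynomial.X : Polynomial K) • (R - A).map Polynomial.C
  have hM (t : K) : M.map (Polynomial.aeval t) = A + t • (R - A) := by
    ext i j
    simp [M]
  let q : Polynomial K := evalPair M (B.map Polynomial.C) f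
  let d : Polynomial K := (krylov M (Polynomial.C ∘ v)).det
  have hq (t : K) : q.eval t = evalPair (A + t • (R - A)) B f := by
    rw [← Polynomial.coe_aeval_eq_eval, map_evalPair, hM]
    congr 2
    ext i j
    simp
  have hd (t : K) : d.eval t = (krylov (A + t • (R - A)) v).det := by
    rw [← hM]
    refine (map_det_krylov (Polynomial.evalRingHom t) _ _).trans ?_
    congr 2
    ext i
    simp
  have hd0 : d ≠ 0 := by
    intro h
    have := hd 1
    simp only [h, Polynomial.eval_zero, one_smul, add_sub_cancel] at this
    exact hR this.symm
  have hqd : q * d = 0 := by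
    refine Polynomial.funext fun t => ?_
    rw [Polynomial.eval_mul, Polynomial.eval_zero, mul_eq_zero, or_iff_not_imp_right]
    intro ht
    rw [hd] at ht
    have hc : Commute (A + t • (R - A)) B := hAB.add_left ((hRB.sub_left hAB).smul_left t)
    obtain ⟨c, hc⟩ := eq_sum_pow_of_commute ht hc
    rw [hq, hc]
    exact evalPair_sum_pow_eq_zero hf _ _
  have hq0 := hq 0
  rw [(mul_eq_zero.1 hqd).resolve_right hd0] at hq0
  simpa using hq0.symm

/-- Up to radical, `commIdeal` is the ideal of pairs `(A, p(A))`: a commuting pair `(A, B)` is joined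
by the line of pairs `(A + t (R - A), B)` to one where `R` is cyclic and commutes with `B`. -/
theorem radical_commIdeal [IsAlgClosed K] (hn : 1 ≤ n) :
    (commIdeal K n).radical = RingHom.ker (paramHom K n) := by
  apply le_antisymm
  · exact (RingHom.ker_isPrime _).radical_le_iff.2 commIdeal_le_ker_paramHom
  · intro f hf
    rw [← vanishingIdeal_zeroLocus_eq_radical (K := K)]
    intro x hx
    let A : Matrix (Fin n) (Fin n) K := Matrix.of fun i j => x (Sum.inl (i, j))
    let B : Matrix (Fin n) (Fin n) K := Matrix.of fun i j => x (Sum.inr (i, j))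
    have hx' : aeval x = evalPair (K := K) A B := by
      ext (ij | ij) <;> simp [evalPair, A, B]
    rw [hx']
    refine evalPair_eq_zero_of_commute hn hf ?_
    rw [← commIdeal_le_ker_evalPair_iff (K := K), ← hx']
    exact hx

theorem isAlgebraic_range_paramHom [IsAlgClosed K] (hn : 1 ≤ n) :
    Algebra.IsAlgebraic (paramHom K n).range (ParamRing K n) := by
  obtain ⟨R, v, -, hR⟩ := exists_commute_det_krylov_ne_zero hn (0 : Matrix (Fin n) (Fin n) K)
  let φ := (paramHom K n).rangeRestrict
  let A := (Xgen K n).map φ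
  let w : Fin n → (paramHom K n).range := algebraMap K _ ∘ v
  let d := (krylov A w).det
  let s := (krylov A w).adjugate *ᵥ ((Ygen K n).map φ *ᵥ w)
  let ι := algebraMap (paramHom K n).range (ParamRing K n)
  have hA : A.map ι = paramX K n := Xgen_map_evalPair (K := K) _ (paramY K n)
  have hY : ((Ygen K n).map φ).map ι = paramY K n := Ygen_map_evalPair (K := K) (paramX K n) _
  have hd0 : d ≠ 0 := by
    intro h
    apply hR
    let g : ParamRing K n →ₐ[K] K := aeval (Sum.elim (fun ij => R ij.1 ij.2) 0)
    have h1 : g (ι d) = 0 := by rw [h, map_zero, map_zero]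
    have h2 : g (ι d) = (krylov ((A.map ι).map g) (g ∘ ι ∘ w)).det := by
      rw [map_det_krylov]
      exact map_det_krylov g.toRingHom _ _
    rw [← h1, h2, hA]
    congr 2
    · ext i j
      simp [paramX, g]
    · ext i
      exact (g.commutes (v i)).symm
  have hs (k : Fin n) : ι d * X (Sum.inr k) = ι (s k) := by
    have h1 : krylov (A.map ι) (ι ∘ w) *ᵥ (fun k => X (Sum.inr k)) =
        paramY K n *ᵥ (ι ∘ w) := by
      rw [krylov_mulVec, hA, paramY]
    rw [RingHom.map_mulVec]
    have h2 : (krylov A w).adjugate.map ι = (krylov (A.map ι) (ι ∘ w)).adjugate := by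
      rw [← krylov_map]
      exact RingHom.map_adjugate ι _
    have h3 : ι ∘ ((Ygen K n).map φ *ᵥ w) = paramY K n *ᵥ (ι ∘ w) := by
      ext i
      rw [Function.comp_apply, RingHom.map_mulVec, hY]
    rw [h2, h3, ← h1, mulVec_mulVec, adjugate_mul, map_det_krylov, smul_mulVec, one_mulVec]
    rfl
  have hgen (i : (Fin n × Fin n) ⊕ Fin n) :
      IsAlgebraic (paramHom K n).range (X i : ParamRing K n) := by
    obtain ij | k := i
    · have : ι (A ij.1 ij.2) = X (Sum.inl ij) := congrFun₂ hA ij.1 ij.2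
      rw [← this]
      exact isAlgebraic_algebraMap _
    · refine ⟨Polynomial.C d * Polynomial.X - Polynomial.C (s k), fun h => ?_, ?_⟩
      · exact hd0 (by simpa using congrArg (fun p => p.coeff 1) h)
      · rw [map_sub, map_mul, Polynomial.aeval_C, Polynomial.aeval_C, Polynomial.aeval_X,
          sub_eq_zero]
        exact hs k
  refine ⟨fun p => ?_⟩
  induction p using MvPolynomial.induction_on with
  | C a => exact isAlgebraic_algebraMap (algebraMap K (paramHom K n).range a)
  | add p q hp hq => exact hp.add hq
  | mul_X p i hp => exact hp.mul (hgen i)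

theorem trdeg_range_paramHom [IsAlgClosed K] (hn : 1 ≤ n) :
    Algebra.trdeg K (paramHom K n).range = (n ^ 2 + n : ℕ) := by
  have := isAlgebraic_range_paramHom (K := K) hn
  obtain ⟨ι, x, hx⟩ := exists_isTranscendenceBasis' K (paramHom K n).range
  have h := (hx.algebraMap_comp (A := ParamRing K n)).lift_cardinalMk_eq_trdeg
  rw [← Cardinal.lift_inj.{0, 0}, ← hx.lift_cardinalMk_eq_trdeg, h,
    MvPolynomial.trdeg_of_isDomain]
  simp [sq]

end parametrization

/-- For every `n ≥ 1`, `Spec R(n)` is irreducible (equivalently, the nilradical of `R(n)` is a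
prime ideal) and the Krull dimension of `R(n)` equals `n² + n`. -/
theorem Rring_irreducible_and_dim (K : Type) [Field K] [IsAlgClosed K]
    (n : ℕ) (hn : 1 ≤ n) :
    (nilradical (Rring K n)).IsPrime ∧
      ringKrullDim (Rring K n) = ((n ^ 2 + n : ℕ) : WithBot ℕ∞) := by
  let ψ : Rring K n →ₐ[K] (paramHom K n).range :=
    Ideal.Quotient.liftₐ (commIdeal K n) (paramHom K n).rangeRestrict fun f hf =>
      Subtype.ext (commIdeal_le_ker_paramHom hf)
  have hψ : Function.Surjective ψ := by
    intro y
    obtain ⟨f, rfl⟩ := (paramHom K n).rangeRestrict_surjective y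
    exact ⟨Ideal.Quotient.mk _ f, rfl⟩
  have hker : RingHom.ker ψ = nilradical (Rring K n) := by
    ext y
    obtain ⟨f, rfl⟩ := Ideal.Quotient.mk_surjective y
    have h1 : Ideal.Quotient.mk (commIdeal K n) f ∈ RingHom.ker ψ ↔
        f ∈ RingHom.ker (paramHom K n) := Subtype.ext_iff
    rw [h1, ← radical_commIdeal hn, mem_nilradical, Ideal.mem_radical_iff]
    simp only [IsNilpotent, ← map_pow, Ideal.Quotient.eq_zero_iff_mem]
  refine ⟨hker ▸ RingHom.ker_isPrime _, ?_⟩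
  have : Algebra.FiniteType K (paramHom K n).range :=
    .of_surjective ((paramHom K n).rangeRestrict) (paramHom K n).rangeRestrict_surjective
  rw [← ringKrullDim_quotient_nilradical, ← hker,
    ringKrullDim_eq_of_ringEquiv (RingHom.quotientKerEquivOfSurjective hψ),
    ringKrullDim_eq_of_trdeg_eq (trdeg_range_paramHom hn)]
end
end

section
/- For every m ≥ 1, the set CV(m)^o is Zariski-dense in CV(m); that is, the Zariski closure of CV(m)^o equals CV(m). -/
open MvPolynomial Matrix

noncomputable section

/-- Coordinates on the ambient affine space of `CV(m)`:
entries of `A`, entries of `B`, entries of `α`, entries of `β`, and `a, b`. -/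
abbrev CVvar (m : ℕ) := (Fin m × Fin m) ⊕ (Fin m × Fin m) ⊕ Fin m ⊕ Fin m ⊕ Fin 2

/-- Points of the ambient affine space. -/
abbrev Pt (K : Type) (m : ℕ) := CVvar m → K

/-- The Zariski topology on affine space `K^ι`: the closed sets are the zero loci of sets of
polynomials, i.e. the topology generated by the basic open sets `{x | p(x) ≠ 0}`. -/
def zariskiTopology (K : Type) [CommRing K] (ι : Type) : TopologicalSpace (ι → K) :=
  TopologicalSpace.generateFrom
    {U | ∃ p : MvPolynomial ι K, U = {x | MvPolynomial.eval x p ≠ 0}}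

instance (K : Type) [Field K] (m : ℕ) : TopologicalSpace (Pt K m) :=
  zariskiTopology K (CVvar m)

/-- The matrix `A` of a point. -/
def Amat (K : Type) [Field K] (m : ℕ) (z : Pt K m) : Matrix (Fin m) (Fin m) K :=
  Matrix.of fun i j => z (Sum.inl (i, j))

/-- The matrix `B` of a point. -/
def Bmat (K : Type) [Field K] (m : ℕ) (z : Pt K m) : Matrix (Fin m) (Fin m) K :=
  Matrix.of fun i j => z (Sum.inr (Sum.inl (i, j)))

/-- The column vector `α` of a point. -/
def alphav (K : Type) [Field K] (m : ℕ) (z : Pt K m) : Fin m → K :=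
  fun i => z (Sum.inr (Sum.inr (Sum.inl i)))

/-- The row vector `β` of a point. -/
def betav (K : Type) [Field K] (m : ℕ) (z : Pt K m) : Fin m → K :=
  fun i => z (Sum.inr (Sum.inr (Sum.inr (Sum.inl i))))

/-- The scalar `a` of a point. -/
def aval (K : Type) [Field K] (m : ℕ) (z : Pt K m) : K :=
  z (Sum.inr (Sum.inr (Sum.inr (Sum.inr 0))))

/-- The scalar `b` of a point. -/
def bval (K : Type) [Field K] (m : ℕ) (z : Pt K m) : K :=
  z (Sum.inr (Sum.inr (Sum.inr (Sum.inr 1))))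

/-- `CV(m) = {(A,B,α,β,a,b) | AB = BA, Aα = aα, βB = bβ, βα = 0}`. -/
def CVset (K : Type) [Field K] (m : ℕ) : Set (Pt K m) :=
  {z | Amat K m z * Bmat K m z = Bmat K m z * Amat K m z ∧
    (Amat K m z).mulVec (alphav K m z) = aval K m z • alphav K m z ∧
    Matrix.vecMul (betav K m z) (Bmat K m z) = bval K m z • betav K m z ∧
    ∑ i, betav K m z i * alphav K m z i = 0}

/-- The diagonal `diag(a₀ I_{m₁}, a₁, …, a_{m-m₁})`. -/
def diagA (K : Type) [Field K] (m m₁ : ℕ) (a : Fin (m - m₁ + 1) → K) : Fin m → K :=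
  fun i => if h : (i : ℕ) < m₁ then a 0
    else a ⟨(i : ℕ) - m₁ + 1, by have := i.isLt; omega⟩

/-- The diagonal `diag(b₁, …, b_{m-m₂}, b₀ I_{m₂})`. -/
def diagB (K : Type) [Field K] (m m₂ : ℕ) (b : Fin (m - m₂ + 1) → K) : Fin m → K :=
  fun i => if h : (i : ℕ) < m - m₂ then b ⟨(i : ℕ) + 1, by omega⟩ else b 0

/-- The column vector `(α, 0)ᵗ`. -/
def alphaFull (K : Type) [Field K] (m m₁ : ℕ) (α : Fin m₁ → K) : Fin m → K :=
  fun i => if h : (i : ℕ) < m₁ then α ⟨(i : ℕ), h⟩ else 0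

/-- The row vector `(0, β)`. -/
def betaFull (K : Type) [Field K] (m m₂ : ℕ) (β : Fin m₂ → K) : Fin m → K :=
  fun i => if h : (i : ℕ) < m - m₂ then 0
    else β ⟨(i : ℕ) - (m - m₂), by have := i.isLt; omega⟩

/-- The point `ψ_{m,m₁,m₂}(g, a, b, α, β)`. -/
def psiPoint (K : Type) [Field K] (m m₁ m₂ : ℕ) (g : GL (Fin m) K)
    (a : Fin (m - m₁ + 1) → K) (b : Fin (m - m₂ + 1) → K)
    (α : Fin m₁ → K) (β : Fin m₂ → K) : Pt K m :=
  fun s =>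
    match s with
    | Sum.inl (i, j) =>
        ((g : Matrix (Fin m) (Fin m) K) * Matrix.diagonal (diagA K m m₁ a) *
          ((g⁻¹ : GL (Fin m) K) : Matrix (Fin m) (Fin m) K)) i j
    | Sum.inr (Sum.inl (i, j)) =>
        ((g : Matrix (Fin m) (Fin m) K) * Matrix.diagonal (diagB K m m₂ b) *
          ((g⁻¹ : GL (Fin m) K) : Matrix (Fin m) (Fin m) K)) i j
    | Sum.inr (Sum.inr (Sum.inl i)) =>
        ((g : Matrix (Fin m) (Fin m) K)).mulVec (alphaFull K m m₁ α) i
    | Sum.inr (Sum.inr (Sum.inr (Sum.inl i))) =>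
        Matrix.vecMul (betaFull K m m₂ β)
          ((g⁻¹ : GL (Fin m) K) : Matrix (Fin m) (Fin m) K) i
    | Sum.inr (Sum.inr (Sum.inr (Sum.inr 0))) => a 0
    | Sum.inr (Sum.inr (Sum.inr (Sum.inr 1))) => b 0

/-- The image of `ψ_{m,m₁,m₂}` (with `Λ_i` the set of tuples with pairwise distinct
coordinates, i.e. injective functions). -/
def psiImage (K : Type) [Field K] (m m₁ m₂ : ℕ) : Set (Pt K m) :=
  {z | ∃ (g : GL (Fin m) K) (a : Fin (m - m₁ + 1) → K) (b : Fin (m - m₂ + 1) → K)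
      (α : Fin m₁ → K) (β : Fin m₂ → K),
    Function.Injective a ∧ Function.Injective b ∧ z = psiPoint K m m₁ m₂ g a b α β}

/-- `CV(m)° `, the union of the images of `ψ_{m,m₁,m₂}` over all `0 ≤ m₁, m₂` with
`m₁ + m₂ ≤ m`. -/
def CVo (K : Type) [Field K] (m : ℕ) : Set (Pt K m) :=
  ⋃ (m₁ : ℕ) (m₂ : ℕ) (_ : m₁ + m₂ ≤ m), psiImage K m m₁ m₂

open Module in
/-- A vector killed by `A ^ n` is killed by an endomorphism commuting with `A` which is the
identity on a subspace of codimension at most `n` in `ker A`. -/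
theorem exists_commute_apply_eq_zero {K V : Type} [Field K] [AddCommGroup V] [Module K V]
    [FiniteDimensional K V] {A : V →ₗ[K] V} (hA : IsNilpotent A) (n : ℕ) (α : V)
    (h : (A ^ n) α = 0) :
    ∃ R : V →ₗ[K] V, A * R = R * A ∧ R α = 0 ∧
      finrank K (LinearMap.ker A) ≤
        n + finrank K (LinearMap.ker A ⊓ LinearMap.ker (1 - R) : Submodule K V) := by
  classical
  induction n generalizing α with
  | zero => exact ⟨1, by simp, by simpa using h, by
      rw [sub_self, LinearMap.ker_zero, inf_top_eq, zero_add]⟩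
  | succ n ih =>
    obtain ⟨R', hc, hR', hd⟩ := ih (A α) (by rw [pow_succ] at h; simpa using h)
    have hA0 : A (R' α) = 0 := by
      have := congrArg (fun f => f α) hc
      simp only [Module.End.mul_apply] at this
      rw [this, hR']
    by_cases h0 : R' α = 0
    · exact ⟨R', hc, h0, by omega⟩
    have hex : ∃ k, R' α ∉ LinearMap.range (A ^ k) := by
      obtain ⟨k, hk⟩ := hA
      exact ⟨k, by simpa [hk] using h0⟩
    obtain ⟨k, hk⟩ : ∃ k, Nat.find hex = k + 1 := by
      refine Nat.exists_eq_succ_of_ne_zero fun hz => ?_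
      have := Nat.find_spec hex
      rw [hz] at this
      exact this (by simp [Module.End.one_eq_id])
    have hk1 : R' α ∉ LinearMap.range (A ^ (k + 1)) := hk ▸ Nat.find_spec hex
    obtain ⟨y, hy⟩ : R' α ∈ LinearMap.range (A ^ k) := by
      by_contra hcon
      exact Nat.find_min hex (m := k) (by omega) hcon
    obtain ⟨φ', hφ'0, hφ'⟩ := Submodule.exists_le_ker_of_notMem hk1
    obtain ⟨φ, hφ1, hφ⟩ : ∃ φ : V →ₗ[K] K, φ (R' α) = 1 ∧ ∀ v, φ ((A ^ (k + 1)) v) = 0 := by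
      refine ⟨(φ' (R' α))⁻¹ • φ', by simp [hφ'0], fun v => ?_⟩
      have : φ' ((A ^ (k + 1)) v) = 0 := hφ' ⟨v, rfl⟩
      simp [this]
    have hAy : (A ^ (k + 1)) y = 0 := by rw [pow_succ', Module.End.mul_apply, hy, hA0]
    let G : V →ₗ[K] V := ∑ i ∈ Finset.range (k + 1), (φ ∘ₗ (A ^ (k - i))).smulRight ((A ^ i) y)
    have hG : ∀ v, G v = ∑ i ∈ Finset.range (k + 1), φ ((A ^ (k - i)) v) • (A ^ i) y := fun v => by
      simp [G]
    have hGc : ∀ v, A (G v) = G (A v) := by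
      intro v
      rw [hG, hG, map_sum, Finset.sum_range_succ, Finset.sum_range_succ']
      congr 1
      · refine Finset.sum_congr rfl fun i hi => ?_
        rw [Finset.mem_range] at hi
        rw [map_smul, ← Module.End.mul_apply, ← pow_succ', ← Module.End.mul_apply _ A, ← pow_succ]
        congr 4
        omega
      · rw [map_smul, ← Module.End.mul_apply, ← pow_succ', hAy, ← Module.End.mul_apply _ A,
          ← pow_succ, Nat.sub_zero, hφ]
        simp
    have hGker : ∀ v, A v = 0 → G v = φ v • R' α := by
      intro v hv
      rw [hG, Finset.sum_range_succ, Finset.sum_eq_zero, zero_add, Nat.sub_self, hy]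
      · simp
      · intro i hi
        rw [Finset.mem_range] at hi
        obtain ⟨j, hj⟩ : ∃ j, k - i = j + 1 := ⟨k - i - 1, by omega⟩
        rw [hj, pow_succ, Module.End.mul_apply, hv]
        simp
    refine ⟨(1 - G) * R', ?_, ?_, ?_⟩
    · ext v
      have := congrArg (fun f => f v) hc
      simp only [Module.End.mul_apply] at this
      simp [Module.End.mul_apply, hGc, this]
    · simp [Module.End.mul_apply, hGker _ hA0, hφ1]
    · have hle : (LinearMap.ker A ⊓ LinearMap.ker (1 - R')) ⊓ LinearMap.ker φ ≤
          LinearMap.ker A ⊓ LinearMap.ker (1 - (1 - G) * R') := by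
        rintro v ⟨⟨hv1, hv2⟩, hv3⟩
        simp only [SetLike.mem_coe, LinearMap.mem_ker, LinearMap.sub_apply,
          Module.End.one_apply] at hv1 hv2 hv3
        refine ⟨hv1, ?_⟩
        have : R' v = v := (sub_eq_zero.mp hv2).symm
        simp [Module.End.mul_apply, this, hGker v hv1, hv3]
      have h1 := Submodule.finrank_mono hle
      have h2 := Submodule.finrank_sup_add_finrank_inf_eq
        (LinearMap.ker A ⊓ LinearMap.ker (1 - R')) (LinearMap.ker φ)
      have h3 := Submodule.finrank_le
        ((LinearMap.ker A ⊓ LinearMap.ker (1 - R')) ⊔ LinearMap.ker φ)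
      have h4 := LinearMap.finrank_range_add_finrank_ker φ
      have h5 : finrank K (LinearMap.range φ) ≤ 1 := by
        simpa using Submodule.finrank_le (LinearMap.range φ)
      omega

open Module in
/-- The dual of `exists_commute_apply_eq_zero`, for linear forms. -/
theorem exists_commute_comp_eq_zero {K V : Type} [Field K] [AddCommGroup V] [Module K V]
    [FiniteDimensional K V] {A : V →ₗ[K] V} (hA : IsNilpotent A) (n : ℕ) (β : Dual K V)
    (h : β ∘ₗ (A ^ n) = 0) (hn : n < finrank K (LinearMap.ker A)) :
    ∃ R : V →ₗ[K] V, A * R = R * A ∧ β ∘ₗ R = 0 ∧ ∃ v, v ≠ 0 ∧ R v = v := by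
  have hpow : ∀ n, A.dualMap ^ n = (A ^ n).dualMap := by
    intro n
    induction n with
    | zero => ext; simp
    | succ n ih => rw [pow_succ, ih, pow_succ']; ext; simp
  have hA' : IsNilpotent A.dualMap := by
    obtain ⟨k, hk⟩ := hA
    exact ⟨k, by rw [hpow, hk]; ext; simp⟩
  obtain ⟨R', hc, hR, hd⟩ := exists_commute_apply_eq_zero hA' n β (by rw [hpow]; exact h)
  have hker : finrank K (LinearMap.ker A.dualMap) = finrank K (LinearMap.ker A) := by
    have h1 := LinearMap.finrank_range_add_finrank_ker A
    have h2 := LinearMap.finrank_range_add_finrank_ker A.dualMap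
    rw [LinearMap.finrank_range_dualMap_eq_finrank_range, Subspace.dual_finrank_eq] at h2
    omega
  obtain ⟨φ, hφ, hφ0⟩ : ∃ φ : Dual K V, R' φ = φ ∧ φ ≠ 0 := by
    obtain ⟨φ, hφ, hφ0⟩ := (Submodule.ne_bot_iff
      (LinearMap.ker A.dualMap ⊓ LinearMap.ker (1 - R') : Submodule K _)).mp fun hb => by
        rw [hb, finrank_bot] at hd; omega
    exact ⟨φ, (sub_eq_zero.mp (by simpa using hφ.2)).symm, hφ0⟩
  let R : V →ₗ[K] V := (evalEquiv K V).symm ∘ₗ R'.dualMap ∘ₗ (evalEquiv K V)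
  have hRe : ∀ (ψ : Dual K V) v, ψ (R v) = R' ψ v := by
    intro ψ v
    simp [R]
  refine ⟨R, ?_, ?_, ?_⟩
  · refine LinearMap.ext fun v => ?_
    rw [← sub_eq_zero, ← Module.forall_dual_apply_eq_zero_iff K]
    intro ψ
    rw [map_sub, sub_eq_zero]
    have := congrArg (fun f => f ψ v) hc
    simp only [Module.End.mul_apply, LinearMap.dualMap_apply] at this
    have h2 := hRe (A.dualMap ψ) v
    simp only [LinearMap.dualMap_apply] at h2
    rw [Module.End.mul_apply, Module.End.mul_apply, h2, hRe, this]
  · ext v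
    simp [hRe, hR]
  · have hsub : LinearMap.ker (1 - R : V →ₗ[K] V) ≠ ⊥ := by
      intro hb
      have hs : Function.Surjective (1 - R : V →ₗ[K] V) :=
        LinearMap.surjective_of_injective (LinearMap.ker_eq_bot.mp hb)
      refine hφ0 (LinearMap.ext fun v => ?_)
      obtain ⟨w, rfl⟩ := hs v
      simp [hRe, hφ]
    obtain ⟨v, hv, hv0⟩ := (Submodule.ne_bot_iff _).mp hsub
    exact ⟨v, hv0, (sub_eq_zero.mp (by simpa using hv)).symm⟩

/-- The algebra of polynomial functions on a vector space. -/
def polyFun (K E : Type) [Field K] [AddCommGroup E] [Module K E] : Subalgebra K (E → K) :=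
  Algebra.adjoin K (Set.range fun (l : Module.Dual K E) (x : E) => l x)

/-- The Zariski closure of a subset of a vector space: the common zeros of the polynomial
functions vanishing on it. -/
def zariskiClosure (K : Type) {E : Type} [Field K] [AddCommGroup E] [Module K E] (S : Set E) :
    Set E :=
  {z | ∀ f ∈ polyFun K E, (∀ s ∈ S, f s = 0) → f z = 0}

section ZariskiClosure

variable {K E F : Type} [Field K] [AddCommGroup E] [Module K E] [AddCommGroup F] [Module K F]

theorem subset_zariskiClosure (S : Set E) : S ⊆ zariskiClosure K S :=
  fun z hz _ _ h => h z hz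

theorem dual_mem_polyFun (l : Module.Dual K E) : (fun x => l x) ∈ polyFun K E :=
  Algebra.subset_adjoin ⟨l, rfl⟩

theorem const_mem_polyFun (c : K) : (fun _ => c) ∈ polyFun K E :=
  (polyFun K E).algebraMap_mem c

theorem polyFun_comp {Φ : E → F} (hΦ : ∀ l : Module.Dual K F, (fun x => l (Φ x)) ∈ polyFun K E)
    {f : F → K} (hf : f ∈ polyFun K F) : (fun x => f (Φ x)) ∈ polyFun K E := by
  refine Algebra.adjoin_induction (p := fun f _ => (fun x => f (Φ x)) ∈ polyFun K E)
    ?_ ?_ ?_ ?_ hf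
  · rintro _ ⟨l, rfl⟩
    exact hΦ l
  · exact fun r => const_mem_polyFun r
  · exact fun f g _ _ hf hg => (polyFun K E).add_mem hf hg
  · exact fun f g _ _ hf hg => (polyFun K E).mul_mem hf hg

/-- Affine maps preserve Zariski closures. -/
theorem affine_mem_zariskiClosure (L : E →ₗ[K] F) (c : F) {S : Set E} {T : Set F}
    (h : ∀ s ∈ S, L s + c ∈ zariskiClosure K T) {z : E} (hz : z ∈ zariskiClosure K S) :
    L z + c ∈ zariskiClosure K T := by
  intro f hf hfT
  refine hz (fun x => f (L x + c)) (polyFun_comp (fun l => ?_) hf) fun s hs => h s hs f hf hfT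
  simp only [map_add]
  exact (polyFun K E).add_mem (dual_mem_polyFun (l ∘ₗ L)) (const_mem_polyFun (l c))

open Polynomial in
/-- A rational curve without pole at `0` which generically lies in a Zariski closure has its
point at `0` in this closure. -/
theorem curve_mem_zariskiClosure [Infinite K] {S : Set E} (γ : K → E) (q r : K[X])
    (hq : q.eval 0 ≠ 0) (hr : r ≠ 0)
    (hγ : ∀ l : Module.Dual K E, ∃ P : K[X], ∀ t, q.eval t ≠ 0 → l (γ t) * q.eval t = P.eval t)
    (hS : ∀ t, q.eval t ≠ 0 → r.eval t ≠ 0 → γ t ∈ zariskiClosure K S) :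
    γ 0 ∈ zariskiClosure K S := by
  intro f hf hfS
  obtain ⟨P, N, hP⟩ : ∃ (P : K[X]) (N : ℕ), ∀ t, q.eval t ≠ 0 →
      f (γ t) * q.eval t ^ N = P.eval t := by
    refine Algebra.adjoin_induction (p := fun f _ => ∃ (P : K[X]) (N : ℕ), ∀ t, q.eval t ≠ 0 →
      f (γ t) * q.eval t ^ N = P.eval t) ?_ ?_ ?_ ?_ hf
    · rintro _ ⟨l, rfl⟩
      obtain ⟨P, hP⟩ := hγ l
      exact ⟨P, 1, by simpa using hP⟩
    · exact fun r => ⟨Polynomial.C r, 0, by simp⟩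
    · rintro f g - - ⟨P, N, hP⟩ ⟨Q, M, hQ⟩
      refine ⟨P * q ^ M + Q * q ^ N, N + M, fun t ht => ?_⟩
      simp only [Polynomial.eval_add, Polynomial.eval_mul, Polynomial.eval_pow, ← hP t ht,
        ← hQ t ht, Pi.add_apply]
      ring
    · rintro f g - - ⟨P, N, hP⟩ ⟨Q, M, hQ⟩
      refine ⟨P * Q, N + M, fun t ht => ?_⟩
      simp only [Polynomial.eval_mul, ← hP t ht, ← hQ t ht, Pi.mul_apply]
      ring
  have hq0 : q ≠ 0 := by
    rintro rfl
    simp at hq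
  have hz : P * (q * r) = 0 := by
    refine Polynomial.funext fun t => ?_
    by_cases h1 : q.eval t = 0
    · simp [h1]
    by_cases h2 : r.eval t = 0
    · simp [h2]
    simp [← hP t h1, hS t h1 h2 f hf hfS]
  have hP0 : P = 0 := by simpa [hq0, hr] using hz
  have := hP 0 hq
  simpa [hP0, hq] using this

open Polynomial in
/-- A line which generically lies in a Zariski closure is contained in it. -/
theorem line_mem_zariskiClosure [Infinite K] {S : Set E} (z w : E) (r : K[X]) (hr : r ≠ 0)
    (hS : ∀ t, r.eval t ≠ 0 → z + t • w ∈ zariskiClosure K S) :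
    z ∈ zariskiClosure K S := by
  have := curve_mem_zariskiClosure (S := S) (fun t => z + t • w) 1 r (by simp) hr
    (fun l => ⟨.C (l z) + .X * .C (l w), fun t _ => by simp [mul_comm t]⟩) (fun t _ => hS t)
  simpa using this

end ZariskiClosure

/-- Two endomorphisms, a vector and a linear form. -/
abbrev Quad (K V : Type) [Field K] [AddCommGroup V] [Module K V] :=
  (V →ₗ[K] V) × (V →ₗ[K] V) × V × Module.Dual K V

/-- The quadruples `(A, B, α, β)` with `A`, `B` commuting, `A α = 0`, `β B = 0`, `β α = 0`. -/
structure IsCV {K V : Type} [Field K] [AddCommGroup V] [Module K V] (A B : V →ₗ[K] V) (α : V)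
    (β : Module.Dual K V) : Prop where
  comm : ∀ v, A (B v) = B (A v)
  left : A α = 0
  right : ∀ v, β (B v) = 0
  pair : β α = 0

/-- The quadruples which are simultaneously diagonal in some basis. -/
def diagQuad (K V : Type) [Field K] [AddCommGroup V] [Module K V] : Set (Quad K V) :=
  {z | ∃ (ι : Type) (_ : Fintype ι) (b : Module.Basis ι K V) (d e : ι → K),
    (∀ i, z.1 (b i) = d i • b i) ∧ (∀ i, z.2.1 (b i) = e i • b i) ∧
    ∀ i, d i * b.repr z.2.2.1 i = 0 ∧ z.2.2.2 (b i) * e i = 0 ∧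
      z.2.2.2 (b i) * b.repr z.2.2.1 i = 0}

section Quad

variable {K V : Type} [Field K] [AddCommGroup V] [Module K V]

/-- Extension of a quadruple along an inclusion `i` with retraction `p`. -/
def extendQuad {W : Type} [AddCommGroup W] [Module K W] (i : W →ₗ[K] V) (p : V →ₗ[K] W) :
    Quad K W →ₗ[K] Quad K V where
  toFun z := (i ∘ₗ z.1 ∘ₗ p, i ∘ₗ z.2.1 ∘ₗ p, i z.2.2.1, z.2.2.2 ∘ₗ p)
  map_add' x y := by
    ext <;> simp
  map_smul' c x := by
    ext <;> simp

theorem extend_add_extend_mem_diagQuad {X Y : Submodule K V} (h : IsCompl X Y)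
    {x : Quad K X} {y : Quad K Y} (hx : x ∈ diagQuad K X) (hy : y ∈ diagQuad K Y) :
    extendQuad X.subtype (X.projectionOnto Y h) x +
      extendQuad Y.subtype (Y.projectionOnto X h.symm) y ∈ diagQuad K V := by
  obtain ⟨ι, _, b, d, e, h1, h2, h3⟩ := hx
  obtain ⟨κ, _, c, d', e', h1', h2', h3'⟩ := hy
  let bc := (b.prod c).map (Submodule.prodEquivOfIsCompl X Y h)
  have hl : ∀ i, bc (Sum.inl i) = b i := fun i => by simp [bc]
  have hr : ∀ i, bc (Sum.inr i) = c i := fun i => by simp [bc]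
  have hrepr : ∀ (u : X) (v : Y), (bc.repr (u + v : V) : ι ⊕ κ → K) =
      Sum.elim (b.repr u) (c.repr v) := by
    intro u v
    have : (Submodule.prodEquivOfIsCompl X Y h).symm (u + v : V) = (u, v) := by
      rw [LinearEquiv.symm_apply_eq]; simp
    ext (i | i) <;> simp [bc, this]
  refine ⟨ι ⊕ κ, inferInstance, bc, Sum.elim d d', Sum.elim e e', ?_, ?_, ?_⟩
  · rintro (i | i) <;> simp [hl, hr, extendQuad, h1, h1']
  · rintro (i | i) <;> simp [hl, hr, extendQuad, h2, h2']
  · have hα := hrepr x.2.2.1 y.2.2.1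
    rintro (i | i)
    · have := h3 i
      simpa [hl, extendQuad, -map_add, -mul_eq_zero, hα] using this
    · have := h3' i
      simpa [hr, extendQuad, -map_add, -mul_eq_zero, hα] using this

/-- Gluing of Zariski closures along a direct sum decomposition. -/
theorem mem_zariskiClosure_diagQuad_of_isCompl {X Y : Submodule K V} (h : IsCompl X Y)
    {A B : V →ₗ[K] V} {α : V} {β : Module.Dual K V} (hz : IsCV A B α β)
    (hAX : ∀ x ∈ X, A x ∈ X) (hBX : ∀ x ∈ X, B x ∈ X)
    (hAY : ∀ x ∈ Y, A x ∈ Y) (hBY : ∀ x ∈ Y, B x ∈ Y)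
    (hαβ : β (X.projectionOnto Y h α) = 0)
    (ihX : ∀ A B α β, IsCV A B α β → (A, B, α, β) ∈ zariskiClosure K (diagQuad K X))
    (ihY : ∀ A B α β, IsCV A B α β → (A, B, α, β) ∈ zariskiClosure K (diagQuad K Y)) :
    (A, B, α, β) ∈ zariskiClosure K (diagQuad K V) := by
  have hdec : ∀ v : V, (X.projectionOnto Y h v : V) + Y.projectionOnto X h.symm v = v :=
    fun v => by simpa using Submodule.projection_add_projection_eq_self h v
  have hαβ' : β (Y.projectionOnto X h.symm α) = 0 := by
    have := hz.pair
    rw [← hdec α, map_add, hαβ, zero_add] at this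
    exact this
  have hA := hz.left
  rw [← hdec α, map_add] at hA
  have hA1 : A (X.projectionOnto Y h α) = 0 := by
    refine (Submodule.disjoint_def.mp h.disjoint) _ (hAX _ (Subtype.mem _)) ?_
    rw [eq_neg_of_add_eq_zero_left hA]
    exact Y.neg_mem (hAY _ (Subtype.mem _))
  have hA2 : A (Y.projectionOnto X h.symm α) = 0 := by
    rw [hA1, zero_add] at hA
    exact hA
  have hX := ihX (A.restrict hAX) (B.restrict hBX) (X.projectionOnto Y h α) (β ∘ₗ X.subtype)
    ⟨fun v => Subtype.ext (hz.comm v), Subtype.ext hA1, fun v => hz.right v, hαβ⟩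
  have hY := ihY (A.restrict hAY) (B.restrict hBY) (Y.projectionOnto X h.symm α) (β ∘ₗ Y.subtype)
    ⟨fun v => Subtype.ext (hz.comm v), Subtype.ext hA2, fun v => hz.right v, hαβ'⟩
  set LX := extendQuad X.subtype (X.projectionOnto Y h) with hLX
  set LY := extendQuad Y.subtype (Y.projectionOnto X h.symm) with hLY
  have key := affine_mem_zariskiClosure (T := diagQuad K V) LX (LY (_, _, _, _)) (fun x hx => by
    rw [add_comm]
    exact affine_mem_zariskiClosure LY (LX x) (fun y hy => by
      rw [add_comm]
      exact subset_zariskiClosure _ (extend_add_extend_mem_diagQuad h hx hy)) hY) hX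
  convert key using 1
  refine Prod.ext ?_ (Prod.ext ?_ (Prod.ext ?_ ?_))
  · refine LinearMap.ext fun v => ?_
    conv_lhs => rw [← hdec v]
    simp [LX, LY, extendQuad]
  · refine LinearMap.ext fun v => ?_
    conv_lhs => rw [← hdec v]
    simp [LX, LY, extendQuad]
  · exact (hdec α).symm
  · refine LinearMap.ext fun v => ?_
    conv_lhs => rw [← hdec v]
    simp [LX, LY, extendQuad]

end Quad

section Splitting

variable {K V : Type} [Field K] [AddCommGroup V] [Module K V]

theorem exists_dual_pow_apply_eq (B R : V →ₗ[K] V) {v : V} (hv : R v = v) (n : ℕ)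
    (l : Module.Dual K V) : ∃ P : Polynomial K, P.natDegree ≤ n ∧ P.coeff n = l v ∧
      ∀ t, l (((B + t • R) ^ n) v) = P.eval t := by
  induction n generalizing l with
  | zero => exact ⟨.C (l v), by simp, by simp, by simp⟩
  | succ n ih =>
    obtain ⟨P, hP, hP', h⟩ := ih (l ∘ₗ B)
    obtain ⟨Q, hQ, hQ', h'⟩ := ih (l ∘ₗ R)
    refine ⟨P + .X * Q, ?_, ?_, fun t => ?_⟩
    · refine (Polynomial.natDegree_add_le _ _).trans (max_le (by omega) ?_)
      exact Polynomial.natDegree_mul_le.trans (by have := Polynomial.natDegree_X_le (R := K); omega)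
    · rw [Polynomial.coeff_add, Polynomial.coeff_X_mul, hQ',
        Polynomial.coeff_eq_zero_of_natDegree_lt (by omega)]
      simp [hv]
    · rw [pow_succ', Module.End.mul_apply]
      simp [← h, ← h']

variable [FiniteDimensional K V]

/-- Density of the diagonalisable quadruples on all proper subspaces of `V`. -/
def DenseOnProper (K V : Type) [Field K] [AddCommGroup V] [Module K V] : Prop :=
  ∀ W : Submodule K V, W ≠ ⊤ → ∀ A B α β, IsCV A B α β →
    (A, B, α, β) ∈ zariskiClosure K (diagQuad K W)

/-- Fitting decomposition along an endomorphism commuting with `A` and `B`. -/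
theorem IsCV.mem_zariskiClosure_of_fitting (ih : DenseOnProper K V) {A B : V →ₗ[K] V} {α : V}
    {β : Module.Dual K V} (hz : IsCV A B α β) (f : Module.End K V) (hfA : ∀ v, f (A v) = A (f v))
    (hfB : ∀ v, f (B v) = B (f v)) (hnil : ¬ IsNilpotent f) (hinj : ¬ Function.Injective f)
    (hf : f α = 0 ∨ ∀ v, β (f v) = 0) :
    (A, B, α, β) ∈ zariskiClosure K (diagQuad K V) := by
  obtain ⟨n, h, hn⟩ := (f.eventually_isCompl_ker_pow_range_pow.and
    (Filter.eventually_ge_atTop 1)).exists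
  obtain ⟨n, rfl⟩ : ∃ k, n = k + 1 := ⟨n - 1, by omega⟩
  have hpow : ∀ g : V →ₗ[K] V, (∀ v, f (g v) = g (f v)) → ∀ n v, (f ^ n) (g v) = g ((f ^ n) v) := by
    intro g hg n
    induction n with
    | zero => simp
    | succ n ihn => intro v; rw [pow_succ, Module.End.mul_apply, Module.End.mul_apply, hg, ihn]
  have hker : ∀ g : V →ₗ[K] V, (∀ v, f (g v) = g (f v)) →
      ∀ x ∈ LinearMap.ker (f ^ (n + 1)), g x ∈ LinearMap.ker (f ^ (n + 1)) := by
    intro g hg x hx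
    rw [LinearMap.mem_ker] at hx ⊢
    rw [hpow g hg, hx, map_zero]
  have hrange : ∀ g : V →ₗ[K] V, (∀ v, f (g v) = g (f v)) →
      ∀ x ∈ LinearMap.range (f ^ (n + 1)), g x ∈ LinearMap.range (f ^ (n + 1)) := by
    rintro g hg _ ⟨x, rfl⟩
    exact ⟨g x, hpow g hg _ _⟩
  have hX : LinearMap.ker (f ^ (n + 1)) ≠ ⊤ := fun h' => hnil ⟨n + 1, LinearMap.ker_eq_top.mp h'⟩
  have hY : LinearMap.range (f ^ (n + 1)) ≠ ⊤ := by
    intro h'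
    refine hinj (LinearMap.injective_iff_surjective.mpr fun v => ?_)
    obtain ⟨w, hw⟩ := LinearMap.range_eq_top.mp h' v
    exact ⟨(f ^ n) w, by rw [← hw, pow_succ']; rfl⟩
  refine mem_zariskiClosure_diagQuad_of_isCompl h hz (hker A hfA) (hker B hfB) (hrange A hfA)
    (hrange B hfB) ?_ (ih _ hX) (ih _ hY)
  rcases hf with hf | hf
  · have : α ∈ LinearMap.ker (f ^ (n + 1)) := by
      rw [LinearMap.mem_ker, pow_succ, Module.End.mul_apply, hf, map_zero]
    rw [show α = ((⟨α, this⟩ : LinearMap.ker (f ^ (n + 1))) : V) from rfl,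
      Submodule.projectionOnto_apply_left]
    exact hz.pair
  · have h1 := Submodule.projection_add_projection_eq_self h α
    have h2 : β ((LinearMap.range (f ^ (n + 1))).projectionOnto _ h.symm α) = 0 := by
      obtain ⟨w, hw⟩ := ((LinearMap.range (f ^ (n + 1))).projectionOnto _ h.symm α).2
      rw [← hw, pow_succ', Module.End.mul_apply, hf]
    have h3 := hz.pair
    rw [← h1, map_add] at h3
    have h4 : β ((LinearMap.range (f ^ (n + 1))).projection _ h.symm α) = 0 := h2
    rw [h4, add_zero] at h3
    exact h3

/-- A line whose direction has eigenvalue one is generically not nilpotent. -/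
theorem exists_not_isNilpotent_add_smul (B R : V →ₗ[K] V) {v : V} (hv0 : v ≠ 0) (hv : R v = v) :
    ∃ r : Polynomial K, r ≠ 0 ∧ ∀ t, r.eval t ≠ 0 → ¬ IsNilpotent (B + t • R) := by
  obtain ⟨l, hl⟩ : ∃ l : Module.Dual K V, l v ≠ 0 := by
    by_contra! h
    exact hv0 ((Module.forall_dual_apply_eq_zero_iff K v).mp h)
  obtain ⟨P, -, hP, h⟩ := exists_dual_pow_apply_eq B R hv (Module.finrank K V) l
  refine ⟨P, ?_, fun t ht hnil => ht ?_⟩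
  · rintro rfl
    exact hl (by simpa using hP.symm)
  · obtain ⟨k, hk⟩ := hnil
    rw [← h, LinearMap.mem_ker.mp (Module.End.ker_pow_le_ker_pow_finrank (B + t • R) k
      (by simp [hk] : v ∈ LinearMap.ker ((B + t • R) ^ k))), map_zero]

variable [Infinite K]

theorem IsCV.mem_zariskiClosure_of_line_right (ih : DenseOnProper K V) {A B : V →ₗ[K] V} {α : V}
    {β : Module.Dual K V} (hz : IsCV A B α β) {R : V →ₗ[K] V} (hAR : A * R = R * A)
    (hβR : β ∘ₗ R = 0) {β' : Module.Dual K V} (hβ' : β' ≠ 0) (hβ'B : β' ∘ₗ B = 0)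
    (hβ'R : β' ∘ₗ R = 0) {v : V} (hv0 : v ≠ 0) (hv : R v = v) :
    (A, B, α, β) ∈ zariskiClosure K (diagQuad K V) := by
  obtain ⟨r, hr, h⟩ := exists_not_isNilpotent_add_smul B R hv0 hv
  refine line_mem_zariskiClosure _ (0, R, 0, 0) r hr fun t ht => ?_
  have hc : ∀ v, A (R v) = R (A v) := fun v => LinearMap.congr_fun hAR v
  have hc' : ∀ v, (B + t • R) (A v) = A ((B + t • R) v) := fun v => by
    simp [hz.comm, hc]
  have hb : ∀ v, β ((B + t • R) v) = 0 := fun v => by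
    simp [hz.right, show β (R v) = 0 from LinearMap.congr_fun hβR v]
  have hz' : IsCV A (B + t • R) α β := ⟨fun v => (hc' v).symm, hz.left, hb, hz.pair⟩
  have := hz'.mem_zariskiClosure_of_fitting ih (B + t • R) hc' (fun _ => rfl) (h t ht)
    (fun hinj => hβ' ?_) (Or.inr hb)
  · simpa using this
  · refine LinearMap.ext fun v => ?_
    obtain ⟨w, rfl⟩ := (LinearMap.injective_iff_surjective.mp hinj) v
    simp [show β' (R w) = 0 from LinearMap.congr_fun hβ'R w,
      show β' (B w) = 0 from LinearMap.congr_fun hβ'B w]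

theorem IsCV.mem_zariskiClosure_of_line_left (ih : DenseOnProper K V) {A B : V →ₗ[K] V} {α : V}
    {β : Module.Dual K V} (hz : IsCV A B α β) {R : V →ₗ[K] V} (hBR : B * R = R * B)
    (hRα : R α = 0) {α' : V} (hα' : α' ≠ 0) (hAα' : A α' = 0)
    (hRα' : R α' = 0) {v : V} (hv0 : v ≠ 0) (hv : R v = v) :
    (A, B, α, β) ∈ zariskiClosure K (diagQuad K V) := by
  obtain ⟨r, hr, h⟩ := exists_not_isNilpotent_add_smul A R hv0 hv
  refine line_mem_zariskiClosure _ (R, 0, 0, 0) r hr fun t ht => ?_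
  have hc : ∀ v, B (R v) = R (B v) := fun v => LinearMap.congr_fun hBR v
  have hc' : ∀ v, (A + t • R) (B v) = B ((A + t • R) v) := fun v => by
    simp [hz.comm, hc]
  have ha : (A + t • R) α = 0 := by simp [hz.left, hRα]
  have hz' : IsCV (A + t • R) B α β := ⟨hc', ha, hz.right, hz.pair⟩
  have := hz'.mem_zariskiClosure_of_fitting ih (A + t • R) (fun _ => rfl) hc' (h t ht)
    (fun hinj => hα' (hinj (by simp [hAα', hRα']))) (Or.inl ha)
  simpa using this

end Splitting

/-- The vectors `w, N w, N² w, …` up to the last non-zero one are linearly independent. -/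
theorem linearIndependent_pow_apply {K W : Type} [Field K] [AddCommGroup W] [Module K W]
    (N : Module.End K W) (w : W) (n : ℕ) (h : (N ^ n) w = 0)
    (h' : ∀ k < n, (N ^ k) w ≠ 0) : LinearIndependent K (fun i : Fin n => (N ^ (i : ℕ)) w) := by
  rw [Fintype.linearIndependent_iff]
  intro g hg
  have hge : ∀ k, n ≤ k → (N ^ k) w = 0 := fun k hk => by
    obtain ⟨j, rfl⟩ := Nat.exists_eq_add_of_le' hk
    rw [pow_add, Module.End.mul_apply, h, map_zero]
  suffices ∀ k (hk : k < n), g ⟨k, hk⟩ = 0 from fun i => this i i.2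
  intro k
  induction k using Nat.strong_induction_on with
  | _ k ihk =>
    intro hk
    have h1 := congrArg (N ^ (n - 1 - k)) hg
    rw [map_zero, map_sum, Finset.sum_eq_single ⟨k, hk⟩] at h1
    · rw [map_smul, ← Module.End.mul_apply, ← pow_add] at h1
      exact (smul_eq_zero.mp h1).resolve_right (h' _ (by simp only; omega))
    · rintro ⟨j, hj⟩ - hjk
      rw [map_smul, ← Module.End.mul_apply, ← pow_add]
      rcases lt_or_gt_of_ne (fun h : j = k => hjk (Fin.ext h)) with hlt | hlt
      · rw [ihk j hlt hj, zero_smul]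
      · rw [hge _ (by simp only; omega), smul_zero]
    · simp

/-- Linearly independent linear forms take arbitrary values. -/
theorem LinearIndependent.surjective_pi {K V ι : Type} [Field K] [AddCommGroup V] [Module K V]
    [Fintype ι] {φ : ι → Module.Dual K V} (h : LinearIndependent K φ) :
    Function.Surjective (LinearMap.pi φ) := by
  classical
  rw [← LinearMap.range_eq_top]
  by_contra hne
  obtain ⟨f, hf, hle⟩ := Submodule.exists_le_ker_of_lt_top _ (lt_top_iff_ne_top.mpr hne)
  have hsum : ∀ x : ι → K, f x = ∑ i, f (Pi.single i 1) * x i := fun x => by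
    rw [LinearMap.pi_apply_eq_sum_univ f x]
    refine Finset.sum_congr rfl fun i _ => ?_
    rw [smul_eq_mul, mul_comm]
    congr 2
    ext j
    simp [Pi.single_apply, eq_comm]
  have := Fintype.linearIndependent_iff.mp h (fun i => f (Pi.single i 1)) (by
    ext v
    have h1 : f (LinearMap.pi φ v) = 0 := hle ⟨v, rfl⟩
    rw [hsum] at h1
    simpa using h1)
  exact hf (LinearMap.ext fun x => by
    rw [hsum, LinearMap.zero_apply]
    exact Finset.sum_eq_zero fun i _ => by rw [this, zero_mul])

section Resolvent

variable {K V : Type} [Field K] [AddCommGroup V] [Module K V]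

/-- Polynomial solution, up to a polynomial factor, of the equation `(1 + t S) x = w`. -/
theorem exists_polynomial_resolvent [FiniteDimensional K V] (S : V →ₗ[K] V) (w : V) :
    ∃ (q : Polynomial K) (x : K → V), q.eval 0 ≠ 0 ∧
      (∀ t, x t + t • S (x t) = q.eval t • w) ∧
      ∀ l : Module.Dual K V, ∃ P : Polynomial K, ∀ t, l (x t) = P.eval t := by
  classical
  let b := Module.finBasis K V
  let M := LinearMap.toMatrix b b S
  let P : Matrix _ _ (Polynomial K) := 1 + (Polynomial.X : Polynomial K) • M.map Polynomial.C
  have hP : ∀ t, (Polynomial.evalRingHom t).mapMatrix P = 1 + t • M := by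
    intro t
    ext i j
    by_cases hij : i = j <;> simp [P, hij, mul_comm t]
  have hdet : ∀ t, P.det.eval t = (1 + t • M).det := by
    intro t
    rw [← hP, ← RingHom.map_det]
    rfl
  let x : K → V := fun t => b.equivFun.symm ((1 + t • M).adjugate *ᵥ b.equivFun w)
  refine ⟨P.det, x, by simp [hdet], fun t => ?_, fun l => ?_⟩
  · apply b.equivFun.injective
    have h1 : b.equivFun (S (x t)) = M *ᵥ b.equivFun (x t) :=
      (LinearMap.toMatrix_mulVec_repr b b S (x t)).symm
    have h2 : b.equivFun (x t) = (1 + t • M).adjugate *ᵥ b.equivFun w :=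
      b.equivFun.apply_symm_apply _
    rw [map_add, map_smul, map_smul, h1, hdet, h2]
    have : (1 + t • M) *ᵥ ((1 + t • M).adjugate *ᵥ b.equivFun w) =
        (1 + t • M).det • b.equivFun w := by
      rw [Matrix.mulVec_mulVec, Matrix.mul_adjugate, Matrix.smul_mulVec, Matrix.one_mulVec]
    rw [← this, Matrix.add_mulVec, Matrix.one_mulVec, Matrix.smul_mulVec]
  · refine ⟨∑ i, (∑ j, P.adjugate i j * .C (b.equivFun w j)) * .C (l (b i)), fun t => ?_⟩
    have hadj : ∀ i j, (P.adjugate i j).eval t = (1 + t • M).adjugate i j := by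
      intro i j
      rw [← hP, ← RingHom.map_adjugate]
      rfl
    simp only [x, Module.Basis.equivFun_symm_apply, map_sum, map_smul, Polynomial.eval_finsetSum,
      Polynomial.eval_mul, Polynomial.eval_C, hadj, smul_eq_mul]
    rfl

/-- A projection onto the common kernel of the forms `β A ^ i` which almost commutes with `A`. -/
theorem exists_almost_commuting_projection (A : Module.End K V) (β : Module.Dual K V) (k : ℕ)
    (hk : ∀ v, β ((A ^ k) v) = 0)
    (hli : LinearIndependent K fun i : Fin k => β ∘ₗ (A ^ (i : ℕ))) :
    ∃ (R : V →ₗ[K] V) (w : V), (∀ v, ∀ i < k, β ((A ^ i) (R v)) = 0) ∧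
      (∀ v, (∀ i < k, β ((A ^ i) v) = 0) → R v = v) ∧ (∀ i < k, β ((A ^ i) w) = 0) ∧
      ∀ v, A (R v) = R (A v) + β v • w := by
  have hge : ∀ j, k ≤ j → ∀ v, β ((A ^ j) v) = 0 := fun j hj v => by
    obtain ⟨i, rfl⟩ := Nat.exists_eq_add_of_le hj
    rw [pow_add, Module.End.mul_apply, hk]
  obtain ⟨v₀, hv₀⟩ := hli.surjective_pi fun i => if (i : ℕ) = k - 1 then 1 else 0
  have hv : ∀ i, β ((A ^ i) v₀) = if i + 1 = k then 1 else 0 := by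
    intro i
    by_cases hi : i < k
    · have := congrFun hv₀ ⟨i, hi⟩
      simp only [LinearMap.pi_apply, LinearMap.comp_apply] at this
      rw [this]
      congr 1
      exact propext ⟨fun h => by omega, fun h => by omega⟩
    · rw [hge i (by omega), if_neg (by omega)]
  let R : V →ₗ[K] V := LinearMap.id -
    ∑ i ∈ Finset.range k, (β ∘ₗ (A ^ (k - 1 - i))).smulRight ((A ^ i) v₀)
  have hR : ∀ v, R v = v - ∑ i ∈ Finset.range k, β ((A ^ (k - 1 - i)) v) • (A ^ i) v₀ := by
    intro v
    simp [R]
  refine ⟨R, -(A ^ k) v₀, ?_, ?_, ?_, ?_⟩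
  · intro v i hi
    simp only [hR, map_sub, map_sum, map_smul, ← Module.End.mul_apply, ← pow_add, hv]
    rw [Finset.sum_eq_single (k - 1 - i), if_pos (by omega),
      show k - 1 - (k - 1 - i) = i by omega]
    · simp
    · intro j hj hne
      rw [Finset.mem_range] at hj
      rw [if_neg (by omega), smul_zero]
    · intro h
      rw [Finset.mem_range] at h
      omega
  · intro v h
    rw [hR, Finset.sum_eq_zero, sub_zero]
    intro i hi
    rw [Finset.mem_range] at hi
    rw [h _ (by omega), zero_smul]
  · intro i _
    rw [map_neg, map_neg, ← Module.End.mul_apply, ← pow_add, hge _ (by omega), neg_zero]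
  · intro v
    have h1 := Finset.sum_range_succ (fun i => β ((A ^ (k - i)) v) • (A ^ i) v₀) k
    rw [Finset.sum_range_succ'] at h1
    simp only [tsub_zero, hk, zero_smul, add_zero, Nat.sub_self, pow_zero,
      Module.End.one_apply] at h1
    have h2 : A (∑ i ∈ Finset.range k, β ((A ^ (k - 1 - i)) v) • (A ^ i) v₀) =
        ∑ i ∈ Finset.range k, β ((A ^ (k - (i + 1))) v) • (A ^ (i + 1)) v₀ := by
      rw [map_sum]
      refine Finset.sum_congr rfl fun i _ => ?_
      rw [map_smul, pow_succ' A i, Module.End.mul_apply, show k - 1 - i = k - (i + 1) by omega]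
    have h3 : ∑ i ∈ Finset.range k, β ((A ^ (k - 1 - i)) (A v)) • (A ^ i) v₀ =
        ∑ i ∈ Finset.range k, β ((A ^ (k - i)) v) • (A ^ i) v₀ := by
      refine Finset.sum_congr rfl fun i hi => ?_
      rw [Finset.mem_range] at hi
      rw [← Module.End.mul_apply, ← pow_succ, show k - 1 - i + 1 = k - i by omega]
    rw [hR, hR, map_sub, h2, h3, h1]
    module

end Resolvent

section Nilpotent

variable {K V : Type} [Field K] [AddCommGroup V] [Module K V]

theorem exists_minimal_pow_apply_eq_zero {W : Type} [AddCommGroup W] [Module K W]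
    {N : Module.End K W} (hN : IsNilpotent N) (w : W) :
    ∃ n, (N ^ n) w = 0 ∧ ∀ k < n, (N ^ k) w ≠ 0 := by
  classical
  have h : ∃ n, (N ^ n) w = 0 := by
    obtain ⟨n, hn⟩ := hN
    exact ⟨n, by simp [hn]⟩
  exact ⟨Nat.find h, Nat.find_spec h, fun k hk => Nat.find_min h hk⟩

theorem dualMap_pow (A : V →ₗ[K] V) (n : ℕ) : A.dualMap ^ n = (A ^ n).dualMap := by
  induction n with
  | zero => ext; simp
  | succ n ih => rw [pow_succ, ih, pow_succ']; ext; simp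

variable [FiniteDimensional K V] [Infinite K]

/-- The case in which `B` has the smallest possible kernel and cokernel. -/
theorem IsCV.mem_zariskiClosure_of_range_eq (ih : DenseOnProper K V) {A B : V →ₗ[K] V} {α : V}
    {β : Module.Dual K V} (hz : IsCV A B α β) (hB : IsNilpotent B) (hβ : β ≠ 0) (k : ℕ)
    (hk : ∀ v, β ((A ^ k) v) = 0)
    (hli : LinearIndependent K fun i : Fin k => β ∘ₗ (A ^ (i : ℕ)))
    (hrange : ∀ v, v ∈ LinearMap.range B ↔ ∀ i < k, β ((A ^ i) v) = 0)
    (hαB : ∃ v ∈ LinearMap.range B, v ≠ 0) :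
    (A, B, α, β) ∈ zariskiClosure K (diagQuad K V) := by
  obtain ⟨R, w, hR, hR', hw, hAR⟩ := exists_almost_commuting_projection A β k hk hli
  have hk0 : 0 < k := by
    rcases Nat.eq_zero_or_pos k with rfl | h
    · exact absurd (LinearMap.ext fun v => by simpa using hk v) hβ
    · exact h
  obtain ⟨w', hw', hw0, hBw'⟩ : ∃ w' ∈ LinearMap.range B, w' ≠ 0 ∧ B w' = 0 := by
    obtain ⟨v, hv, hv0⟩ := hαB
    obtain ⟨n, hn, hn'⟩ := exists_minimal_pow_apply_eq_zero hB v
    rcases n with _ | n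
    · exact absurd (by simpa using hn) hv0
    refine ⟨(B ^ n) v, ?_, hn' n (by omega), by rw [← hn, pow_succ']; rfl⟩
    rcases n with _ | n
    · simpa using hv
    · exact ⟨(B ^ n) v, by rw [pow_succ']; rfl⟩
  obtain ⟨C, hC⟩ : ∃ C : V →ₗ[K] V, ∀ v ∈ LinearMap.range B, B (C v) = v := by
    obtain ⟨C, hC⟩ := B.rangeRestrict.exists_rightInverse_of_surjective
      (LinearMap.range_rangeRestrict B)
    obtain ⟨C', hC'⟩ := C.exists_extend
    refine ⟨C', fun v hv => ?_⟩
    have h1 := LinearMap.congr_fun hC' ⟨v, hv⟩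
    have h2 := LinearMap.congr_fun hC ⟨v, hv⟩
    have h3 := congrArg Subtype.val h2
    rw [LinearMap.comp_apply] at h1
    simpa [← h1] using h3
  obtain ⟨q, x, hq, hx, hxP⟩ := exists_polynomial_resolvent (R ∘ₗ C) w
  have hxr : ∀ t, x t ∈ LinearMap.range B := by
    intro t
    rw [eq_sub_of_add_eq (hx t)]
    exact Submodule.sub_mem _ (Submodule.smul_mem _ _ ((hrange _).mpr hw))
      (Submodule.smul_mem _ _ ((hrange _).mpr (hR _)))
  have hβR : ∀ v, β (R v) = 0 := fun v => by simpa using hR v 0 hk0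
  let γ : K → Quad K V := fun t =>
    (A + (t * (q.eval t)⁻¹) • β.smulRight (C (x t)), B + t • R, α, β)
  have h0 : γ 0 = (A, B, α, β) := by simp [γ]
  rw [← h0]
  refine curve_mem_zariskiClosure γ q .X hq Polynomial.X_ne_zero ?_ ?_
  · intro l
    let L : V →ₗ[K] Quad K V :=
      { toFun := fun y => (β.smulRight (C y), 0, 0, 0)
        map_add' := fun a b => by ext <;> simp
        map_smul' := fun a b =>
          Prod.ext (LinearMap.ext fun v => by simp [smul_comm (β v) a]) (by simp) }
    obtain ⟨P, hP⟩ := hxP (l ∘ₗ L)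
    refine ⟨q * (.C (l (A, B, α, β)) + .X * .C (l (0, R, 0, 0))) + .X * P, fun t ht => ?_⟩
    have : γ t = (A, B, α, β) + (t * (q.eval t)⁻¹) • L (x t) + t • (0, R, 0, 0) := by
      simp [γ, L]
    rw [this, map_add, map_add, map_smul, map_smul, ← LinearMap.comp_apply, hP]
    simp only [smul_eq_mul, Polynomial.eval_add, Polynomial.eval_mul, Polynomial.eval_C,
      Polynomial.eval_X]
    field_simp
    ring
  · intro t ht ht0
    rw [Polynomial.eval_X] at ht0
    have hb : ∀ v, β ((B + t • R) v) = 0 := fun v => by simp [hz.right, hβR]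
    have hBx : (B + t • R) (C (x t)) = q.eval t • w := by
      rw [← hx t, LinearMap.add_apply, hC _ (hxr t)]
      rfl
    have hcomm : ∀ v, (A + (t * (q.eval t)⁻¹) • β.smulRight (C (x t))) ((B + t • R) v) =
        (B + t • R) ((A + (t * (q.eval t)⁻¹) • β.smulRight (C (x t))) v) := by
      intro v
      rw [LinearMap.add_apply A, LinearMap.add_apply A, LinearMap.smul_apply,
        LinearMap.smul_apply, LinearMap.smulRight_apply, LinearMap.smulRight_apply, hb,
        map_add (B + t • R), map_smul, map_smul, hBx]
      simp only [LinearMap.add_apply, LinearMap.smul_apply, map_add, map_smul, hAR, hz.comm]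
      rw [show (t * (q.eval t)⁻¹) • β v • q.eval t • w = t • β v • w by
        rw [smul_comm (β v), smul_smul, mul_assoc, inv_mul_cancel₀ ht, mul_one]]
      simp
      abel
    refine IsCV.mem_zariskiClosure_of_fitting ih (α := α) (β := β)
      ⟨hcomm, by simp [hz.left, hz.pair], hb, hz.pair⟩
      (B + t • R) (fun v => (hcomm v).symm) (fun _ => rfl) ?_ ?_ (Or.inr hb)
    · rintro ⟨n, hn⟩
      have : ∀ n, ((B + t • R) ^ n) w' = t ^ n • w' := by
        intro n
        induction n with
        | zero => simp
        | succ n ihn =>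
          rw [pow_succ', Module.End.mul_apply, ihn, map_smul, LinearMap.add_apply, hBw',
            LinearMap.smul_apply, hR' _ ((hrange _).mp hw'), zero_add, smul_smul, pow_succ]
      have h1 := this n
      rw [hn, LinearMap.zero_apply] at h1
      exact smul_ne_zero (pow_ne_zero n ht0) hw0 h1.symm
    · intro hinj
      refine hβ (LinearMap.ext fun v => ?_)
      obtain ⟨u, rfl⟩ := (LinearMap.injective_iff_surjective.mp hinj) v
      exact hb u

theorem IsCV.mem_zariskiClosure_of_ne_zero (ih : DenseOnProper K V) {A B : V →ₗ[K] V} {α : V}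
    {β : Module.Dual K V} (hz : IsCV A B α β) (hA : IsNilpotent A) (hB : IsNilpotent B)
    (hα : α ≠ 0) (hβ : β ≠ 0) :
    (A, B, α, β) ∈ zariskiClosure K (diagQuad K V) := by
  have hBα : ∀ n, A ((B ^ n) α) = 0 := by
    intro n
    induction n with
    | zero => exact hz.left
    | succ n ihn => rw [pow_succ', Module.End.mul_apply, hz.comm, ihn, map_zero]
  have hβA : ∀ n v, β ((A ^ n) (B v)) = 0 := by
    intro n
    induction n with
    | zero => exact hz.right
    | succ n ihn => intro v; rw [pow_succ, Module.End.mul_apply, hz.comm, ihn]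
  have hA' : IsNilpotent (R := Module.End K (Module.Dual K V)) A.dualMap := by
    obtain ⟨n, hn⟩ := hA
    exact ⟨n, by rw [dualMap_pow, hn]; ext; simp⟩
  obtain ⟨d, hd, hd'⟩ := exists_minimal_pow_apply_eq_zero hB α
  obtain ⟨k, hk, hk'⟩ := exists_minimal_pow_apply_eq_zero hA' β
  have hlid := linearIndependent_pow_apply B α d hd hd'
  have hlik := linearIndependent_pow_apply A.dualMap β k hk hk'
  simp only [dualMap_pow] at hk hlik
  have hlik : LinearIndependent K fun i : Fin k => β ∘ₗ (A ^ (i : ℕ)) := hlik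
  by_cases h1 : k < Module.finrank K (LinearMap.ker A)
  · obtain ⟨R, hAR, hβR, v, hv0, hv⟩ := exists_commute_comp_eq_zero hA k β hk h1
    exact hz.mem_zariskiClosure_of_line_right ih hAR hβR hβ (LinearMap.ext hz.right) hβR hv0 hv
  by_cases h2 : d < Module.finrank K (LinearMap.ker B)
  · obtain ⟨R, hBR, hRα, hdim⟩ := exists_commute_apply_eq_zero hB d α hd
    obtain ⟨v, hv, hv0⟩ := Submodule.exists_mem_ne_zero_of_ne_bot
      (p := LinearMap.ker B ⊓ LinearMap.ker (1 - R)) (by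
        intro h
        rw [h, finrank_bot] at hdim
        omega)
    have hv' : R v = v := by
      have := (Submodule.mem_inf.mp hv).2
      rw [LinearMap.mem_ker, LinearMap.sub_apply, sub_eq_zero] at this
      exact this.symm
    exact hz.mem_zariskiClosure_of_line_left ih hBR hRα hα hz.left hRα hv0 hv'
  have h3 : d ≤ Module.finrank K (LinearMap.ker A) := by
    have : LinearIndependent K fun i : Fin d =>
        (⟨(B ^ (i : ℕ)) α, hBα i⟩ : LinearMap.ker A) :=
      LinearIndependent.of_comp (LinearMap.ker A).subtype hlid
    simpa using this.fintype_card_le_finrank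
  let W := LinearMap.ker (LinearMap.pi fun i : Fin k => β ∘ₗ (A ^ (i : ℕ)))
  have hW : ∀ v, v ∈ W ↔ ∀ i < k, β ((A ^ i) v) = 0 := by
    intro v
    rw [LinearMap.mem_ker]
    exact ⟨fun h i hi => congrFun h ⟨i, hi⟩, fun h => funext fun i => h i i.2⟩
  have hle : LinearMap.range B ≤ W := by
    rintro _ ⟨v, rfl⟩
    exact (hW _).mpr fun i _ => hβA i v
  have hWdim : k + Module.finrank K W = Module.finrank K V := by
    have := LinearMap.finrank_range_add_finrank_ker
      (LinearMap.pi fun i : Fin k => β ∘ₗ (A ^ (i : ℕ)))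
    rw [LinearMap.range_eq_top.mpr hlik.surjective_pi, finrank_top, Module.finrank_fin_fun] at this
    exact this
  have hBdim := LinearMap.finrank_range_add_finrank_ker B
  have hmono := Submodule.finrank_mono hle
  have heq : LinearMap.range B = W := Submodule.eq_of_le_of_finrank_le hle (by omega)
  refine hz.mem_zariskiClosure_of_range_eq ih hB hβ k (LinearMap.congr_fun hk) hlik
    (fun v => by rw [heq, hW]) ⟨α, ?_, hα⟩
  rw [heq, hW]
  intro i hi
  rcases i with _ | i
  · exact hz.pair
  · rw [pow_succ, Module.End.mul_apply, hz.left, map_zero, map_zero]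

end Nilpotent

section DiagonalQuadruples

variable {K V : Type} [Field K] [AddCommGroup V] [Module K V]

theorem shift_mem_zariskiClosure_diagQuad {A B : V →ₗ[K] V} {α : V} {β : Module.Dual K V}
    (h : (A, B, α, β) ∈ zariskiClosure K (diagQuad K V)) (a b c e : K) (hac : a * c = 0)
    (hbe : b * e = 0) :
    (A + a • (1 : V →ₗ[K] V), B + b • (1 : V →ₗ[K] V), c • α, e • β) ∈
      zariskiClosure K (diagQuad K V) := by
  let L : Quad K V →ₗ[K] Quad K V :=
    { toFun := fun z => (z.1, z.2.1, c • z.2.2.1, e • z.2.2.2)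
      map_add' := fun x y => by simp
      map_smul' := fun r x => by simp [smul_comm r] }
  have := affine_mem_zariskiClosure L (a • 1, b • 1, 0, 0) (T := diagQuad K V) ?_ h
  · simpa [L] using this
  rintro ⟨A, B, α, β⟩ ⟨ι, _, v, d, d', h1, h2, h3⟩
  refine subset_zariskiClosure _ ⟨ι, inferInstance, v, fun i => d i + a, fun i => d' i + b,
    fun i => ?_, fun i => ?_, fun i => ?_⟩
  · have := h1 i
    simp only at this
    simp [L, this, add_smul]
  · have := h2 i
    simp only at this
    simp [L, this, add_smul]
  · obtain ⟨h4, h5, h6⟩ := h3 i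
    simp only at h4 h5 h6
    simp only [L, LinearMap.coe_mk, AddHom.coe_mk, Prod.mk_add_mk, add_zero, map_smul,
      Finsupp.smul_apply, smul_eq_mul, LinearMap.smul_apply]
    refine ⟨?_, ?_, ?_⟩
    · linear_combination c * h4 + v.repr α i * hac
    · linear_combination e * h5 + β (v i) * hbe
    · linear_combination c * e * h6

theorem exists_ne_zero_apply_eq_zero [Nontrivial V] {A B : Module.End K V}
    (hAB : ∀ v, A (B v) = B (A v)) (hA : IsNilpotent A) (hB : IsNilpotent B) :
    ∃ v ≠ 0, A v = 0 ∧ B v = 0 := by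
  obtain ⟨v, hv⟩ := exists_ne (0 : V)
  obtain ⟨n, hn, hn'⟩ := exists_minimal_pow_apply_eq_zero hA v
  rcases n with _ | n
  · exact absurd (by simpa using hn) hv
  obtain ⟨m, hm, hm'⟩ := exists_minimal_pow_apply_eq_zero hB ((A ^ n) v)
  rcases m with _ | m
  · exact absurd (by simpa using hm) (hn' n (by omega))
  refine ⟨(B ^ m) ((A ^ n) v), hm' m (by omega), ?_, by rw [← hm, pow_succ' B]; rfl⟩
  have : ∀ m, A ((B ^ m) ((A ^ n) v)) = 0 := by
    intro m
    induction m with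
    | zero => rw [← hn, pow_succ' A]; rfl
    | succ m ihm => rw [pow_succ', Module.End.mul_apply, hAB, ihm, map_zero]
  exact this m

theorem mem_range_of_finrank_ker_le_one [FiniteDimensional K V] {N : Module.End K V}
    (hN : IsNilpotent N) (hV : 2 ≤ Module.finrank K V)
    (hker : Module.finrank K (LinearMap.ker N) ≤ 1) {v : V} (hv : N v = 0) :
    v ∈ LinearMap.range N := by
  have hdim := LinearMap.finrank_range_add_finrank_ker N
  obtain ⟨w, hw, hw0⟩ := Submodule.exists_mem_ne_zero_of_ne_bot (p := LinearMap.range N) (by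
    intro h
    rw [h, finrank_bot] at hdim
    omega)
  obtain ⟨n, hn, hn'⟩ := exists_minimal_pow_apply_eq_zero hN w
  rcases n with _ | n
  · exact absurd (by simpa using hn) hw0
  have hx : (N ^ n) w ∈ LinearMap.range N := by
    rcases n with _ | n
    · simpa using hw
    · exact ⟨(N ^ n) w, by rw [pow_succ']; rfl⟩
  have hx' : N ((N ^ n) w) = 0 := by rw [← hn, pow_succ']; rfl
  obtain ⟨u, hu⟩ := finrank_le_one_iff.mp hker
  obtain ⟨c, hc⟩ := hu ⟨v, hv⟩
  obtain ⟨c', hc'⟩ := hu ⟨(N ^ n) w, hx'⟩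
  have hc1 := congrArg Subtype.val hc
  have hc2 := congrArg Subtype.val hc'
  simp only [Submodule.coe_smul] at hc1 hc2
  have hc0 : c' ≠ 0 := by
    rintro rfl
    exact hn' n (by omega) (by rw [← hc2, zero_smul])
  rw [← hc1, show (u : V) = c'⁻¹ • (N ^ n) w by rw [← hc2, smul_smul, inv_mul_cancel₀ hc0, one_smul]]
  exact Submodule.smul_mem _ _ (Submodule.smul_mem _ _ hx)

variable [FiniteDimensional K V]

theorem IsCV.mem_zariskiClosure_of_isNilpotent [Infinite K] (ih : DenseOnProper K V)
    (hV : 2 ≤ Module.finrank K V) {A B : V →ₗ[K] V} {α : V}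
    {β : Module.Dual K V} (hz : IsCV A B α β) (hA : IsNilpotent A) (hB : IsNilpotent B) :
    (A, B, α, β) ∈ zariskiClosure K (diagQuad K V) := by
  have : Nontrivial V := Module.nontrivial_of_finrank_pos (R := K) (by omega)
  obtain ⟨α', hα', hAα', hBα'⟩ := exists_ne_zero_apply_eq_zero hz.comm hA hB
  have hdual : ∀ N : V →ₗ[K] V, IsNilpotent N →
      IsNilpotent (R := Module.End K (Module.Dual K V)) N.dualMap := by
    rintro N ⟨n, hn⟩
    exact ⟨n, by rw [dualMap_pow, hn]; ext; simp⟩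
  obtain ⟨β', hβ', hβA', hβB'⟩ := exists_ne_zero_apply_eq_zero (A := A.dualMap) (B := B.dualMap)
    (fun l => LinearMap.ext fun v => congrArg l (hz.comm v).symm) (hdual A hA) (hdual B hB)
  have hβA' : β' ∘ₗ A = 0 := hβA'
  have hβB' : β' ∘ₗ B = 0 := hβB'
  rcases eq_or_ne α 0 with rfl | hα
  · by_cases hker : Module.finrank K (LinearMap.ker B) ≤ 1
    · obtain ⟨u, rfl⟩ := mem_range_of_finrank_ker_le_one hB hV hker hBα'
      rcases eq_or_ne β 0 with rfl | hβ
      · have h := IsCV.mem_zariskiClosure_of_ne_zero ih (A := A) (B := B) (α := B u) (β := β')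
          ⟨hz.comm, hAα', LinearMap.congr_fun hβB', LinearMap.congr_fun hβB' u⟩ hA hB hα' hβ'
        simpa using shift_mem_zariskiClosure_diagQuad h 0 0 0 0 (by simp) (by simp)
      · have h := IsCV.mem_zariskiClosure_of_ne_zero ih (A := A) (B := B) (α := B u) (β := β)
          ⟨hz.comm, hAα', hz.right, hz.right u⟩ hA hB hα' hβ
        simpa using shift_mem_zariskiClosure_diagQuad h 0 0 0 1 (by simp) (by simp)
    · obtain ⟨R, hBR, hRα, hdim⟩ := exists_commute_apply_eq_zero hB 1 α' (by simpa using hBα')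
      obtain ⟨v, hv, hv0⟩ := Submodule.exists_mem_ne_zero_of_ne_bot
        (p := LinearMap.ker B ⊓ LinearMap.ker (1 - R)) (by
          intro h
          rw [h, finrank_bot] at hdim
          omega)
      have hv' : R v = v := by
        have := (Submodule.mem_inf.mp hv).2
        rw [LinearMap.mem_ker, LinearMap.sub_apply, sub_eq_zero] at this
        exact this.symm
      exact hz.mem_zariskiClosure_of_line_left ih hBR (map_zero R) hα' hAα' hRα hv0 hv'
  rcases eq_or_ne β 0 with rfl | hβ
  · by_cases hker : Module.finrank K (LinearMap.ker A) ≤ 1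
    · have hβα' : β' α = 0 := by
        obtain ⟨u, hu⟩ := mem_range_of_finrank_ker_le_one hA hV hker hz.left
        rw [← hu]
        exact LinearMap.congr_fun hβA' u
      have h := IsCV.mem_zariskiClosure_of_ne_zero ih (A := A) (B := B) (α := α) (β := β')
        ⟨hz.comm, hz.left, LinearMap.congr_fun hβB', hβα'⟩ hA hB hα hβ'
      simpa using shift_mem_zariskiClosure_diagQuad h 0 0 1 0 (by simp) (by simp)
    · obtain ⟨R, hAR, hβR, v, hv0, hv⟩ := exists_commute_comp_eq_zero hA 1 β'
        (by simpa using hβA') (by omega)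
      exact hz.mem_zariskiClosure_of_line_right ih hAR (LinearMap.zero_comp R) hβ' hβB' hβR hv0 hv
  exact hz.mem_zariskiClosure_of_ne_zero ih hA hB hα hβ

theorem IsCV.mem_diagQuad_of_finrank_le_one (hV : Module.finrank K V ≤ 1) {A B : V →ₗ[K] V} {α : V}
    {β : Module.Dual K V} (hz : IsCV A B α β) : (A, B, α, β) ∈ diagQuad K V := by
  let b := Module.finBasis K V
  have : Subsingleton (Fin (Module.finrank K V)) := Fin.subsingleton_iff_le_one.mpr hV
  have hb : ∀ v i, v = b.repr v i • b i := by
    intro v i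
    refine b.ext_elem fun j => ?_
    rw [Subsingleton.elim j i]
    simp
  refine ⟨Fin (Module.finrank K V), inferInstance, b, fun i => b.repr (A (b i)) i,
    fun i => b.repr (B (b i)) i, fun i => hb _ i, fun i => hb _ i, fun i => ⟨?_, ?_, ?_⟩⟩
  · have := hz.left
    rw [hb α i, map_smul] at this
    simpa [mul_comm] using congrArg (fun v => b.repr v i) this
  · have := hz.right (b i)
    rw [hb (B (b i)) i, map_smul] at this
    simpa [mul_comm] using this
  · have := hz.pair
    rw [hb α i, map_smul] at this
    simpa [mul_comm] using this

end DiagonalQuadruples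

/-- The simultaneously diagonalisable quadruples are dense. -/
theorem IsCV.mem_zariskiClosure {K V : Type} [Field K] [IsAlgClosed K] [AddCommGroup V]
    [Module K V] [FiniteDimensional K V] {A B : V →ₗ[K] V} {α : V} {β : Module.Dual K V}
    (hz : IsCV A B α β) : (A, B, α, β) ∈ zariskiClosure K (diagQuad K V) := by
  induction hn : Module.finrank K V using Nat.strong_induction_on generalizing V with
  | _ n ihn =>
  subst hn
  by_cases hV : Module.finrank K V ≤ 1
  · exact subset_zariskiClosure _ (hz.mem_diagQuad_of_finrank_le_one hV)
  have : Infinite K := IsAlgClosed.instInfinite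
  have ih : DenseOnProper K V := fun W hW A B α β h => ihn _ (Submodule.finrank_lt hW) h rfl
  have : Nontrivial V := Module.nontrivial_of_finrank_pos (R := K) (by omega)
  have heig : ∀ N : Module.End K V, ∃ c : K, ¬ Function.Injective (N - c • (1 : V →ₗ[K] V)) := by
    intro N
    obtain ⟨c, hc⟩ := Module.End.exists_eigenvalue N
    obtain ⟨v, hv⟩ := hc.exists_hasEigenvector
    refine ⟨c, fun h => hv.2 (h ?_)⟩
    simp [hv.apply_eq_smul]
  obtain ⟨a, ha, haα⟩ : ∃ a : K, ¬ Function.Injective (A - a • (1 : V →ₗ[K] V)) ∧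
      (α = 0 ∨ a = 0) := by
    rcases eq_or_ne α 0 with h | h
    · obtain ⟨a, ha⟩ := heig A
      exact ⟨a, ha, Or.inl h⟩
    · exact ⟨0, fun hinj => h (hinj (by simp [hz.left])), Or.inr rfl⟩
  obtain ⟨b, hb, hbβ⟩ : ∃ b : K, ¬ Function.Injective (B - b • (1 : V →ₗ[K] V)) ∧
      (β = 0 ∨ b = 0) := by
    rcases eq_or_ne β 0 with h | h
    · obtain ⟨a, ha⟩ := heig B
      exact ⟨a, ha, Or.inl h⟩
    · refine ⟨0, fun hinj => h (LinearMap.ext fun v => ?_), Or.inr rfl⟩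
      obtain ⟨u, hu⟩ := (LinearMap.injective_iff_surjective.mp hinj) v
      rw [← hu]
      simp [hz.right]
  have hα : (A - a • (1 : V →ₗ[K] V)) α = 0 := by
    rcases haα with h | h <;> simp [h, hz.left]
  have hβ : ∀ v, β ((B - b • (1 : V →ₗ[K] V)) v) = 0 := by
    rcases hbβ with h | h <;> simp [h, hz.right]
  by_cases hA : IsNilpotent (A - a • (1 : V →ₗ[K] V))
  swap
  · exact hz.mem_zariskiClosure_of_fitting ih _ (by simp) (by simp [hz.comm]) hA ha (Or.inl hα)
  by_cases hB : IsNilpotent (B - b • (1 : V →ₗ[K] V))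
  swap
  · exact hz.mem_zariskiClosure_of_fitting ih _ (by simp [hz.comm]) (by simp) hB hb (Or.inr hβ)
  have hz' : IsCV (A - a • (1 : V →ₗ[K] V)) (B - b • (1 : V →ₗ[K] V)) α β := by
    refine ⟨fun v => ?_, hα, hβ, hz.pair⟩
    simp [hz.comm]
    module
  have h := hz'.mem_zariskiClosure_of_isNilpotent ih (by omega) hA hB
  have hc : ∃ c : K, a * c = 0 ∧ c • α = α := by
    rcases haα with h | h
    · exact ⟨0, by simp, by simp [h]⟩
    · exact ⟨1, by simp [h], by simp⟩
  have he : ∃ e : K, b * e = 0 ∧ e • β = β := by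
    rcases hbβ with h | h
    · exact ⟨0, by simp, by simp [h]⟩
    · exact ⟨1, by simp [h], by simp⟩
  obtain ⟨c, hac, hcα⟩ := hc
  obtain ⟨e, hbe, heβ⟩ := he
  simpa [hcα, heβ] using shift_mem_zariskiClosure_diagQuad h a b c e hac hbe

section Affine

variable {K : Type} [Field K]

theorem eval_mem_polyFun {ι : Type} (p : MvPolynomial ι K) :
    (fun z : ι → K => MvPolynomial.eval z p) ∈ polyFun K (ι → K) := by
  induction p using MvPolynomial.induction_on with
  | C c => simpa using const_mem_polyFun c
  | add p q hp hq =>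
    simp only [map_add]
    exact (polyFun K (ι → K)).add_mem hp hq
  | mul_X p i hp =>
    simp only [map_mul, MvPolynomial.eval_X]
    exact (polyFun K (ι → K)).mul_mem hp
      (dual_mem_polyFun (LinearMap.proj i : (ι → K) →ₗ[K] K))

theorem mem_closure_zariskiTopology_iff {ι : Type} {S : Set (ι → K)} {z : ι → K} :
    z ∈ @closure _ (zariskiTopology K ι) S ↔
      ∀ p : MvPolynomial ι K, (∀ s ∈ S, MvPolynomial.eval s p = 0) →
        MvPolynomial.eval z p = 0 := by
  let _ := zariskiTopology K ι
  constructor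
  · intro hz p hp
    have hclosed : IsClosed {x : ι → K | MvPolynomial.eval x p = 0} :=
      ⟨TopologicalSpace.isOpen_generateFrom_of_mem ⟨p, rfl⟩⟩
    exact closure_minimal hp hclosed hz
  · intro h
    have hbasis := TopologicalSpace.isTopologicalBasis_of_subbasis_of_inter
      (t := zariskiTopology K ι) rfl (by
        rintro _ ⟨p, rfl⟩ _ ⟨q, rfl⟩
        exact ⟨p * q, by ext; simp [not_or]⟩)
    rw [hbasis.mem_closure_iff]
    rintro _ (rfl | ⟨p, rfl⟩) hz
    all_goals by_contra hne
    · simpa using h 1 fun s hs => absurd ⟨s, trivial, hs⟩ hne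
    refine hz (h p fun s hs => ?_)
    by_contra h0
    exact hne ⟨s, h0, hs⟩

theorem zariskiClosure_subset_closure {m : ℕ} (S : Set (Pt K m)) :
    zariskiClosure K S ⊆ closure S := fun _ hz =>
  mem_closure_zariskiTopology_iff.mpr fun p hp => hz _ (eval_mem_polyFun p) hp

/-- The point of the ambient affine space with given components. -/
def mkPt {m : ℕ} (A B : Matrix (Fin m) (Fin m) K) (α β : Fin m → K) (a b : K) : Pt K m :=
  fun s =>
    match s with
    | Sum.inl (i, j) => A i j
    | Sum.inr (Sum.inl (i, j)) => B i j
    | Sum.inr (Sum.inr (Sum.inl i)) => α i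
    | Sum.inr (Sum.inr (Sum.inr (Sum.inl i))) => β i
    | Sum.inr (Sum.inr (Sum.inr (Sum.inr 0))) => a
    | Sum.inr (Sum.inr (Sum.inr (Sum.inr 1))) => b

theorem mkPt_eta {m : ℕ} (z : Pt K m) :
    mkPt (Amat K m z) (Bmat K m z) (alphav K m z) (betav K m z) (aval K m z) (bval K m z) = z := by
  funext s
  rcases s with ⟨i, j⟩ | ⟨i, j⟩ | i | i | i
  iterate 4 rfl
  fin_cases i <;> rfl

theorem mkPt_add_smul {m : ℕ} (A B A' B' : Matrix (Fin m) (Fin m) K) (α β α' β' : Fin m → K)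
    (a b a' b' t : K) :
    mkPt A B α β a b + t • mkPt A' B' α' β' a' b' =
      mkPt (A + t • A') (B + t • B') (α + t • α') (β + t • β') (a + t * a') (b + t * b') := by
  funext s
  rcases s with ⟨i, j⟩ | ⟨i, j⟩ | i | i | i
  iterate 4 rfl
  fin_cases i <;> rfl

theorem psiPoint_eq_mkPt {m : ℕ} (m₁ m₂ : ℕ) (g : GL (Fin m) K)
    (a : Fin (m - m₁ + 1) → K) (b : Fin (m - m₂ + 1) → K) (α : Fin m₁ → K) (β : Fin m₂ → K) :
    psiPoint K m m₁ m₂ g a b α β =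
      mkPt ((g : Matrix (Fin m) (Fin m) K) * Matrix.diagonal (diagA K m m₁ a) *
          ((g⁻¹ : GL (Fin m) K) : Matrix (Fin m) (Fin m) K))
        ((g : Matrix (Fin m) (Fin m) K) * Matrix.diagonal (diagB K m m₂ b) *
          ((g⁻¹ : GL (Fin m) K) : Matrix (Fin m) (Fin m) K))
        ((g : Matrix (Fin m) (Fin m) K) *ᵥ alphaFull K m m₁ α)
        (betaFull K m m₂ β ᵥ* ((g⁻¹ : GL (Fin m) K) : Matrix (Fin m) (Fin m) K)) (a 0) (b 0) := by
  funext s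
  rcases s with ⟨i, j⟩ | ⟨i, j⟩ | i | i | i
  iterate 4 rfl
  fin_cases i <;> rfl

theorem psiPoint_mem_CVset {m m₁ m₂ : ℕ} (hm : m₁ + m₂ ≤ m) (g : GL (Fin m) K)
    (a : Fin (m - m₁ + 1) → K) (b : Fin (m - m₂ + 1) → K) (α : Fin m₁ → K) (β : Fin m₂ → K) :
    psiPoint K m m₁ m₂ g a b α β ∈ CVset K m := by
  rw [psiPoint_eq_mkPt]
  set G := (g : Matrix (Fin m) (Fin m) K)
  set H := ((g⁻¹ : GL (Fin m) K) : Matrix (Fin m) (Fin m) K)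
  have hHG : H * G = 1 := Units.inv_mul g
  have hconj : ∀ x y : Fin m → K, G * Matrix.diagonal x * H * (G * Matrix.diagonal y * H) =
      G * Matrix.diagonal (x * y) * H := by
    intro x y
    rw [show G * Matrix.diagonal x * H * (G * Matrix.diagonal y * H) =
      G * Matrix.diagonal x * (H * G) * Matrix.diagonal y * H by simp only [Matrix.mul_assoc],
      hHG, Matrix.mul_one, Matrix.mul_assoc G, Matrix.diagonal_mul_diagonal]
    rfl
  refine ⟨?_, ?_, ?_, ?_⟩
  · exact (hconj _ _).trans ((congrArg (fun x => G * Matrix.diagonal x * H) (mul_comm _ _)).trans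
      (hconj _ _).symm)
  · change (G * Matrix.diagonal (diagA K m m₁ a) * H) *ᵥ (G *ᵥ alphaFull K m m₁ α) =
      a 0 • (G *ᵥ alphaFull K m m₁ α)
    rw [Matrix.mulVec_mulVec, Matrix.mul_assoc, hHG, Matrix.mul_one, ← Matrix.mulVec_mulVec,
      ← Matrix.mulVec_smul]
    congr 1
    ext i
    rw [Matrix.mulVec_diagonal]
    by_cases hi : (i : ℕ) < m₁ <;> simp [diagA, alphaFull, hi]
  · change (betaFull K m m₂ β ᵥ* H) ᵥ* (G * Matrix.diagonal (diagB K m m₂ b) * H) =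
      b 0 • (betaFull K m m₂ β ᵥ* H)
    rw [Matrix.vecMul_vecMul, ← Matrix.mul_assoc, ← Matrix.mul_assoc, hHG, Matrix.one_mul,
      ← Matrix.vecMul_vecMul, ← Matrix.smul_vecMul]
    congr 1
    ext i
    rw [Matrix.vecMul_diagonal]
    by_cases hi : (i : ℕ) < m - m₂ <;> simp [diagB, betaFull, hi, mul_comm]
  · change (betaFull K m m₂ β ᵥ* H) ⬝ᵥ (G *ᵥ alphaFull K m m₁ α) = 0
    rw [Matrix.dotProduct_mulVec, Matrix.vecMul_vecMul, hHG, Matrix.vecMul_one]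
    refine Finset.sum_eq_zero fun i _ => ?_
    by_cases hi : (i : ℕ) < m₁
    · rw [betaFull, dif_pos (by omega), zero_mul]
    · rw [alphaFull, dif_neg hi, mul_zero]

theorem closure_CVo_subset (m : ℕ) : closure (CVo K m) ⊆ CVset K m := by
  intro z hz
  have key : ∀ p : MvPolynomial (CVvar m) K, (∀ s ∈ CVset K m, MvPolynomial.eval s p = 0) →
      MvPolynomial.eval z p = 0 := by
    intro p hp
    refine mem_closure_zariskiTopology_iff.mp hz p fun s hs => hp s ?_
    simp only [CVo, Set.mem_iUnion] at hs
    obtain ⟨m₁, m₂, hm, g, a, b, α, β, -, -, rfl⟩ := hs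
    exact psiPoint_mem_CVset hm g a b α β
  let A (i j : Fin m) : MvPolynomial (CVvar m) K := X (Sum.inl (i, j))
  let B (i j : Fin m) : MvPolynomial (CVvar m) K := X (Sum.inr (Sum.inl (i, j)))
  let α (i : Fin m) : MvPolynomial (CVvar m) K := X (Sum.inr (Sum.inr (Sum.inl i)))
  let β (i : Fin m) : MvPolynomial (CVvar m) K := X (Sum.inr (Sum.inr (Sum.inr (Sum.inl i))))
  let c (i : Fin 2) : MvPolynomial (CVvar m) K := X (Sum.inr (Sum.inr (Sum.inr (Sum.inr i))))
  have h1 : ∀ i j (s : Pt K m), MvPolynomial.eval s (∑ k, A i k * B k j - ∑ k, B i k * A k j) =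
      (Amat K m s * Bmat K m s) i j - (Bmat K m s * Amat K m s) i j := by
    intro i j s
    simp [A, B, Matrix.mul_apply, Amat, Bmat]
  have h2 : ∀ i (s : Pt K m), MvPolynomial.eval s (∑ k, A i k * α k - c 0 * α i) =
      (Amat K m s *ᵥ alphav K m s) i - (aval K m s • alphav K m s) i := by
    intro i s
    simp [A, α, c, Matrix.mulVec, dotProduct, Amat, alphav, aval]
  have h3 : ∀ i (s : Pt K m), MvPolynomial.eval s (∑ k, β k * B k i - c 1 * β i) =
      (betav K m s ᵥ* Bmat K m s) i - (bval K m s • betav K m s) i := by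
    intro i s
    simp [B, β, c, Matrix.vecMul, dotProduct, Bmat, betav, bval]
  have h4 : ∀ s : Pt K m, MvPolynomial.eval s (∑ k, β k * α k) =
      ∑ k, betav K m s k * alphav K m s k := by
    intro s
    simp [α, β, alphav, betav]
  refine ⟨?_, ?_, ?_, ?_⟩
  · ext i j
    rw [← sub_eq_zero, ← h1]
    exact key _ fun s hs => by rw [h1, hs.1, sub_self]
  · ext i
    rw [← sub_eq_zero, ← h2]
    exact key _ fun s hs => by rw [h2, hs.2.1, sub_self]
  · ext i
    rw [← sub_eq_zero, ← h3]
    exact key _ fun s hs => by rw [h3, hs.2.2.1, sub_self]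
  · rw [← h4]
    exact key _ fun s hs => by rw [h4, hs.2.2.2]

/-- A line of tuples with injective direction generically consists of injective tuples. -/
theorem exists_injective_add_smul {n : ℕ} (a δ : Fin n → K) (hδ : Function.Injective δ) :
    ∃ r : Polynomial K, r ≠ 0 ∧ ∀ t, r.eval t ≠ 0 → Function.Injective (a + t • δ) := by
  refine ⟨∏ i, ∏ j, if i = j then 1 else .C (a i - a j) + .C (δ i - δ j) * .X, ?_, ?_⟩
  · refine Finset.prod_ne_zero_iff.mpr fun i _ => Finset.prod_ne_zero_iff.mpr fun j _ => ?_
    split_ifs with h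
    · exact one_ne_zero
    · intro h0
      have := congrArg (fun p => Polynomial.coeff p 1) h0
      simp [Polynomial.coeff_C] at this
      exact h (hδ (sub_eq_zero.mp this))
  · intro t ht i j hij
    by_contra hne
    simp only [Polynomial.eval_prod] at ht
    have := Finset.prod_ne_zero_iff.mp (Finset.prod_ne_zero_iff.mp ht i (Finset.mem_univ i)) j
      (Finset.mem_univ j)
    rw [if_neg hne] at this
    simp only [Polynomial.eval_add, Polynomial.eval_mul, Polynomial.eval_C,
      Polynomial.eval_X] at this
    simp only [Pi.add_apply, Pi.smul_apply, smul_eq_mul] at hij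
    exact this (by linear_combination hij)

theorem psiPoint_mem_zariskiClosure [Infinite K] {m m₁ m₂ : ℕ} (hm : m₁ + m₂ ≤ m)
    (g : GL (Fin m) K) (a : Fin (m - m₁ + 1) → K) (b : Fin (m - m₂ + 1) → K) (α : Fin m₁ → K)
    (β : Fin m₂ → K) : psiPoint K m m₁ m₂ g a b α β ∈ zariskiClosure K (CVo K m) := by
  have hδ : ∀ n, ∃ δ : Fin (n + 1) → K, Function.Injective δ ∧ δ 0 = 0 := by
    intro n
    refine ⟨fun i => Infinite.natEmbedding K i - Infinite.natEmbedding K 0, fun i j hij => ?_, ?_⟩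
    · exact Fin.ext ((Infinite.natEmbedding K).injective (sub_left_injective hij))
    · simp
  obtain ⟨δ, hδ, hδ0⟩ := hδ (m - m₁)
  obtain ⟨ε, hε, hε0⟩ := ‹∀ n, ∃ δ : Fin (n + 1) → K, Function.Injective δ ∧ δ 0 = 0› (m - m₂)
  obtain ⟨r, hr, hr'⟩ := exists_injective_add_smul a δ hδ
  obtain ⟨s, hs, hs'⟩ := exists_injective_add_smul b ε hε
  refine line_mem_zariskiClosure _ (psiPoint K m m₁ m₂ g δ ε 0 0) (r * s) (mul_ne_zero hr hs)
    fun t ht => subset_zariskiClosure _ ?_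
  rw [Polynomial.eval_mul, mul_ne_zero_iff] at ht
  simp only [CVo, Set.mem_iUnion]
  refine ⟨m₁, m₂, hm, g, a + t • δ, b + t • ε, α, β, hr' t ht.1, hs' t ht.2, ?_⟩
  have hA : diagA K m m₁ (a + t • δ) = diagA K m m₁ a + t • diagA K m m₁ δ := by
    ext i
    by_cases hi : (i : ℕ) < m₁ <;> simp [diagA, hi]
  have hB : diagB K m m₂ (b + t • ε) = diagB K m m₂ b + t • diagB K m m₂ ε := by
    ext i
    by_cases hi : (i : ℕ) < m - m₂ <;> simp [diagB, hi]
  have hα : alphaFull K m m₁ (0 : Fin m₁ → K) = 0 := by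
    ext i
    simp [alphaFull]
  have hβ : betaFull K m m₂ (0 : Fin m₂ → K) = 0 := by
    ext i
    simp [betaFull]
  rw [psiPoint_eq_mkPt, psiPoint_eq_mkPt, psiPoint_eq_mkPt, mkPt_add_smul, hA, hB, hα, hβ]
  have hdiag : ∀ x y : Fin m → K, Matrix.diagonal (x + t • y) =
      Matrix.diagonal x + t • Matrix.diagonal y := by
    intro x y
    rw [← Matrix.diagonal_smul, Matrix.diagonal_add]
    rfl
  simp [hdiag, Matrix.mul_add, Matrix.add_mul]

end Affine

section Density

variable {K : Type} [Field K]

/-- A quadruple on `K^m`, regarded as a point of the ambient affine space with `a = b = 0`. -/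
def quadToPt (K : Type) [Field K] (m : ℕ) : Quad K (Fin m → K) →ₗ[K] Pt K m where
  toFun q := mkPt (LinearMap.toMatrix' q.1) (LinearMap.toMatrix' q.2.1) q.2.2.1
    (fun i => q.2.2.2 (Pi.single i 1)) 0 0
  map_add' q q' := by
    have := mkPt_add_smul (LinearMap.toMatrix' q.1) (LinearMap.toMatrix' q.2.1)
      (LinearMap.toMatrix' q'.1) (LinearMap.toMatrix' q'.2.1) q.2.2.1
      (fun i => q.2.2.2 (Pi.single i 1)) q'.2.2.1 (fun i => q'.2.2.2 (Pi.single i 1)) 0 0 0 0 1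
    simp only [one_smul, mul_zero, add_zero] at this
    rw [this]
    simp only [Prod.fst_add, Prod.snd_add, map_add]
    rfl
  map_smul' t q := by
    funext s
    rcases s with ⟨i, j⟩ | ⟨i, j⟩ | i | i | i
    · simp [mkPt]
    · simp [mkPt]
    · simp [mkPt]
    · simp [mkPt]
    · fin_cases i <;> simp [mkPt]

theorem quadToPt_add {m : ℕ} (q : Quad K (Fin m → K)) (a b : K) :
    quadToPt K m q + mkPt (a • 1) (b • 1) 0 0 a b =
      mkPt (LinearMap.toMatrix' q.1 + a • 1) (LinearMap.toMatrix' q.2.1 + b • 1) q.2.2.1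
        (fun i => q.2.2.2 (Pi.single i 1)) a b := by
  have := mkPt_add_smul (LinearMap.toMatrix' q.1) (LinearMap.toMatrix' q.2.1)
    (a • 1) (b • 1) q.2.2.1 (fun i => q.2.2.2 (Pi.single i 1)) 0 0 0 0 a b 1
  simp only [one_smul, one_mul, zero_add, add_zero] at this
  exact this

theorem exists_quad_of_mem_CVset {m : ℕ} {z : Pt K m} (hz : z ∈ CVset K m) :
    ∃ q : Quad K (Fin m → K), IsCV q.1 q.2.1 q.2.2.1 q.2.2.2 ∧
      quadToPt K m q + mkPt (aval K m z • 1) (bval K m z • 1) 0 0 (aval K m z) (bval K m z) = z := by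
  obtain ⟨h1, h2, h3, h4⟩ := hz
  have hβ : ∀ v, dotProductBilin K K (betav K m z) v = betav K m z ⬝ᵥ v := fun _ => rfl
  refine ⟨(Matrix.toLin' (Amat K m z - aval K m z • 1), Matrix.toLin' (Bmat K m z - bval K m z • 1),
    alphav K m z, dotProductBilin K K (betav K m z)), ⟨fun v => ?_, ?_, fun v => ?_, ?_⟩, ?_⟩
  · simp only [Matrix.toLin'_apply, Matrix.mulVec_mulVec]
    congr 1
    simp only [Matrix.sub_mul, Matrix.mul_sub, h1, Matrix.smul_mul, Matrix.mul_smul,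
      Matrix.one_mul, Matrix.mul_one, smul_sub, smul_comm (aval K m z) (bval K m z)]
    abel
  · simp [Matrix.toLin'_apply, h2]
  · rw [hβ, Matrix.toLin'_apply, Matrix.dotProduct_mulVec, Matrix.vecMul_sub, h3,
      Matrix.vecMul_smul, Matrix.vecMul_one, sub_self, zero_dotProduct]
  · rw [hβ]
    exact h4
  · rw [quadToPt_add]
    conv_rhs => rw [← mkPt_eta z]
    simp only [LinearMap.toMatrix'_toLin', sub_add_cancel, hβ, dotProduct_single, mul_one]

/-- A finite type can be enumerated so that a given key is increasing. -/
theorem exists_equiv_fin_monotone {ι : Type} [Fintype ι] {m : ℕ} (h : Fintype.card ι = m)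
    (κ : ι → ℕ) : ∃ σ : Fin m ≃ ι, Monotone (κ ∘ σ) := by
  let e : Fin m ≃ ι := (Fintype.equivFinOfCardEq h).symm
  exact ⟨(Tuple.sort (κ ∘ e)).trans e, Tuple.monotone_sort (κ ∘ e)⟩

theorem exists_initial_segment_of_monotone {m : ℕ} {f : Fin m → ℕ} (hf : Monotone f) (n : ℕ) :
    ∃ k ≤ m, ∀ j : Fin m, (j : ℕ) < k ↔ f j ≤ n :=
  ⟨_, (Finset.card_le_univ _).trans_eq (Fintype.card_fin m),
    fun _ => Tuple.lt_card_le_iff_apply_le_of_monotone hf⟩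

/-- Diagonal quadruples can be sorted into the block shape of the parametrization. -/
theorem exists_sorted_basis {m : ℕ} {q : Quad K (Fin m → K)} (hq : q ∈ diagQuad K (Fin m → K)) :
    ∃ (m₁ m₂ : ℕ) (v : Module.Basis (Fin m) K (Fin m → K)) (d e : Fin m → K), m₁ + m₂ ≤ m ∧
      (∀ i, q.1 (v i) = d i • v i) ∧ (∀ i, q.2.1 (v i) = e i • v i) ∧
      (∀ i : Fin m, (i : ℕ) < m₁ → d i = 0) ∧ (∀ i : Fin m, ¬ (i : ℕ) < m - m₂ → e i = 0) ∧
      (∀ i : Fin m, ¬ (i : ℕ) < m₁ → v.repr q.2.2.1 i = 0) ∧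
      ∀ i : Fin m, (i : ℕ) < m - m₂ → q.2.2.2 (v i) = 0 := by
  classical
  obtain ⟨ι, _, w, d, e, hd, he, h⟩ := hq
  have hcard : Fintype.card ι = m := by
    rw [← Module.finrank_eq_card_basis w, Module.finrank_fin_fun]
  let κ : ι → ℕ := fun i => if w.repr q.2.2.1 i ≠ 0 then 0 else if q.2.2.2 (w i) ≠ 0 then 2 else 1
  obtain ⟨σ, hσ⟩ := exists_equiv_fin_monotone hcard κ
  obtain ⟨k, hk, hk'⟩ := exists_initial_segment_of_monotone hσ 0
  obtain ⟨l, hl, hl'⟩ := exists_initial_segment_of_monotone hσ 1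
  have hkl : k ≤ l := by
    by_contra! hlt
    have h1 := (hk' ⟨l, by omega⟩).mp hlt
    have h2 := (hl' ⟨l, by omega⟩).mpr (h1.trans zero_le_one)
    exact lt_irrefl _ h2
  have h0 : ∀ i, κ i ≤ 0 ↔ w.repr q.2.2.1 i ≠ 0 := by
    intro i
    simp only [κ]
    split_ifs <;> simp_all
  have h1 : ∀ i, κ i ≤ 1 ↔ q.2.2.2 (w i) = 0 := by
    intro i
    have := (h i).2.2
    simp only [κ]
    split_ifs <;> simp_all
  refine ⟨k, m - l, w.reindex σ.symm, d ∘ σ, e ∘ σ, by omega, ?_, ?_, ?_, ?_, ?_, ?_⟩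
  · intro i
    simpa using hd (σ i)
  · intro i
    simpa using he (σ i)
  · intro i hi
    exact (mul_eq_zero.mp (h (σ i)).1).resolve_right ((h0 _).mp ((hk' i).mp hi))
  · intro i hi
    rw [Nat.sub_sub_self hl, hl'] at hi
    exact (mul_eq_zero.mp (h (σ i)).2.1).resolve_left (mt (h1 _).mpr hi)
  · intro i hi
    rw [hk'] at hi
    simpa using mt (h0 _).mpr hi
  · intro i hi
    rw [Nat.sub_sub_self hl, hl'] at hi
    simpa using (h1 _).mp hi

theorem exists_diagA_eq {m m₁ : ℕ} {d : Fin m → K} (hd : ∀ i : Fin m, (i : ℕ) < m₁ → d i = 0)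
    (a : K) : ∃ s : Fin (m - m₁ + 1) → K, s 0 = a ∧ diagA K m m₁ s = fun i => d i + a := by
  refine ⟨fun j => if h : (j : ℕ) ≠ 0 then d ⟨m₁ + j - 1, by omega⟩ + a else a, by simp, ?_⟩
  ext i
  by_cases hi : (i : ℕ) < m₁
  · simp [diagA, hi, hd i hi]
  · have : m₁ + (i - m₁ + 1) - 1 = (i : ℕ) := by omega
    simp [diagA, hi, this]

theorem exists_diagB_eq {m m₂ : ℕ} {e : Fin m → K}
    (he : ∀ i : Fin m, ¬ (i : ℕ) < m - m₂ → e i = 0) (b : K) :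
    ∃ s : Fin (m - m₂ + 1) → K, s 0 = b ∧ diagB K m m₂ s = fun i => e i + b := by
  refine ⟨fun j => if h : (j : ℕ) ≠ 0 then e ⟨j - 1, by omega⟩ + b else b, by simp, ?_⟩
  ext i
  by_cases hi : (i : ℕ) < m - m₂
  · simp [diagB, hi]
  · simp [diagB, hi, he i hi]

theorem exists_alphaFull_eq {m m₁ : ℕ} (hm : m₁ ≤ m) {x : Fin m → K}
    (hx : ∀ i : Fin m, ¬ (i : ℕ) < m₁ → x i = 0) : ∃ s, alphaFull K m m₁ s = x := by
  refine ⟨fun j => x ⟨j, by omega⟩, ?_⟩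
  ext i
  by_cases hi : (i : ℕ) < m₁
  · simp [alphaFull, hi]
  · simp [alphaFull, hi, hx i hi]

theorem exists_betaFull_eq {m m₂ : ℕ} (hm : m₂ ≤ m) {y : Fin m → K}
    (hy : ∀ i : Fin m, (i : ℕ) < m - m₂ → y i = 0) : ∃ s, betaFull K m m₂ s = y := by
  refine ⟨fun j => y ⟨m - m₂ + j, by omega⟩, ?_⟩
  ext i
  by_cases hi : (i : ℕ) < m - m₂
  · simp [betaFull, hi, hy i hi]
  · have : m - m₂ + (i - (m - m₂)) = (i : ℕ) := by omega
    simp [betaFull, hi, this]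

theorem toMatrix'_add_smul_one_eq {m : ℕ} {A : (Fin m → K) →ₗ[K] Fin m → K}
    {v : Module.Basis (Fin m) K (Fin m → K)} {d : Fin m → K} (hd : ∀ i, A (v i) = d i • v i)
    (a : K) {G H : Matrix (Fin m) (Fin m) K} (hG : ∀ i j, G i j = v j i) (hGH : G * H = 1) :
    LinearMap.toMatrix' A + a • 1 = G * Matrix.diagonal (fun i => d i + a) * H := by
  have h : (LinearMap.toMatrix' A + a • 1) * G = G * Matrix.diagonal (fun i => d i + a) := by
    ext i j
    have h1 : (LinearMap.toMatrix' A * G) i j = A (v j) i := by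
      rw [← LinearMap.toMatrix'_mulVec A (v j)]
      simp only [Matrix.mul_apply, Matrix.mulVec, dotProduct, hG]
    rw [Matrix.add_mul, Matrix.add_apply, h1, hd, Matrix.mul_diagonal, hG]
    simp [hG]
    ring
  rw [← h, Matrix.mul_assoc, hGH, Matrix.mul_one]

theorem quadToPt_add_mem_zariskiClosure [Infinite K] {m : ℕ} {q : Quad K (Fin m → K)}
    (hq : q ∈ diagQuad K (Fin m → K)) (a b : K) :
    quadToPt K m q + mkPt (a • 1) (b • 1) 0 0 a b ∈ zariskiClosure K (CVo K m) := by
  obtain ⟨m₁, m₂, v, d, e, hm, hA, hB, hd, he, hx, hy⟩ := exists_sorted_basis hq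
  obtain ⟨s, hs0, hs⟩ := exists_diagA_eq hd a
  obtain ⟨t, ht0, ht⟩ := exists_diagB_eq he b
  obtain ⟨x, hx⟩ := exists_alphaFull_eq (by omega) hx
  obtain ⟨y, hy⟩ := exists_betaFull_eq (y := fun i => q.2.2.2 (v i)) (by omega) hy
  let g : GL (Fin m) K := ⟨(Pi.basisFun K (Fin m)).toMatrix v, v.toMatrix (Pi.basisFun K (Fin m)),
    Module.Basis.toMatrix_mul_toMatrix_flip _ _, Module.Basis.toMatrix_mul_toMatrix_flip _ _⟩
  have hg : ∀ i j, (g : Matrix (Fin m) (Fin m) K) i j = v j i := fun _ _ => rfl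
  have hg' : ∀ i j, ((g⁻¹ : GL (Fin m) K) : Matrix (Fin m) (Fin m) K) i j =
      v.repr (Pi.single j 1) i := by
    intro i j
    rw [← Pi.basisFun_apply]
    rfl
  have hgg : (g : Matrix (Fin m) (Fin m) K) * ((g⁻¹ : GL (Fin m) K) : Matrix (Fin m) (Fin m) K) =
      1 := Units.mul_inv g
  convert psiPoint_mem_zariskiClosure hm g s t x y using 1
  rw [quadToPt_add, psiPoint_eq_mkPt, hs0, ht0, hs, ht, hx, hy,
    toMatrix'_add_smul_one_eq hA a hg hgg, toMatrix'_add_smul_one_eq hB b hg hgg]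
  congr 1
  · ext i
    conv_lhs => rw [← v.sum_repr q.2.2.1]
    simp [Matrix.mulVec, dotProduct, hg, Finset.sum_apply, mul_comm]
  · ext i
    conv_lhs => rw [← v.sum_repr (Pi.single i 1), map_sum]
    simp only [Matrix.vecMul, dotProduct, hg', map_smul, smul_eq_mul, mul_comm]

theorem CVset_subset_closure [IsAlgClosed K] (m : ℕ) : CVset K m ⊆ closure (CVo K m) := by
  intro z hz
  have : Infinite K := IsAlgClosed.instInfinite
  obtain ⟨q, hq, hqz⟩ := exists_quad_of_mem_CVset hz
  rw [← hqz]
  exact zariskiClosure_subset_closure _ (affine_mem_zariskiClosure _ _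
    (fun s hs => quadToPt_add_mem_zariskiClosure hs _ _) hq.mem_zariskiClosure)

end Density

/-- For every `m ≥ 1`, `CV(m)°` is Zariski-dense in `CV(m)`: its Zariski closure equals
`CV(m)`. -/
theorem CVo_dense (K : Type) [Field K] [IsAlgClosed K] (m : ℕ) (hm : 1 ≤ m) :
    closure (CVo K m) = CVset K m := by
  exact (closure_CVo_subset m).antisymm (CVset_subset_closure m)
end
end
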